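/- arXiv:2501.03951 — 3 statements merged into one kernel-verified Lean document; each statement's English description precedes it below -/
import Mathlib

section
/- For every fixed C̃ ≥ 0, the function Ã ↦ F(Ã,C̃) is strictly increasing on (0,∞): for all real numbers 0 < Ã₁ < Ã₂ one has F(Ã₁,C̃) < F(Ã₂,C̃). -/
/-- `F(Ã,C̃) = (1/4)·(∫ e^{-x²/4} x⁴/((x²+Ã²)(x²+C̃²)) dx)/(∫ e^{-x²/4} x²/((x²+Ã²)(x²+C̃²)) dx)`. -/
noncomputable def Fint (A C : ℝ) : ℝ :=
  (1 / 4) * (∫ x : ℝ, Real.exp (-x ^ 2 / 4) * x ^ 4 / ((x ^ 2 + A ^ 2) * (x ^ 2 + C ^ 2))) /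
    ∫ x : ℝ, Real.exp (-x ^ 2 / 4) * x ^ 2 / ((x ^ 2 + A ^ 2) * (x ^ 2 + C ^ 2))

open MeasureTheory in
theorem aux_int (C a : ℝ) (ha : 0 < a) (hC : 0 ≤ C) (n : ℕ) (K : ℝ)
    (hn : ∀ x : ℝ, x ^ n ≤ K * ((x ^ 2 + a ^ 2) * (x ^ 2 + C ^ 2))) (h0 : ∀ x : ℝ, 0 ≤ x ^ n) (hK : 0 ≤ K) :
    Integrable (fun x : ℝ => Real.exp (-x ^ 2 / 4) * x ^ n / ((x ^ 2 + a ^ 2) * (x ^ 2 + C ^ 2))) := by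
  have hg : Integrable (fun x : ℝ => K * Real.exp (-x ^ 2 / 4)) := by
    have := (integrable_exp_neg_mul_sq (b := 1/4) (by norm_num)).const_mul K
    refine this.congr (Filter.Eventually.of_forall fun x => ?_)
    simp only
    congr 2
    ring
  refine hg.mono' (Measurable.aestronglyMeasurable (by fun_prop)) (Filter.Eventually.of_forall fun x => ?_)
  have h1 := hn x
  have h2 := h0 x
  have he := Real.exp_pos (-x ^ 2 / 4)
  have hd : 0 ≤ (x ^ 2 + a ^ 2) * (x ^ 2 + C ^ 2) := by positivity
  rw [Real.norm_of_nonneg (by positivity)]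
  apply div_le_of_le_mul₀ hd (by positivity)
  calc _ ≤ Real.exp (-x ^ 2 / 4) * (K * ((x ^ 2 + a ^ 2) * (x ^ 2 + C ^ 2))) := by gcongr
    _ = _ := by ring

open MeasureTheory in
theorem aux_int4 (C a : ℝ) (ha : 0 < a) (hC : 0 ≤ C) :
    Integrable (fun x : ℝ => Real.exp (-x ^ 2 / 4) * x ^ 4 / ((x ^ 2 + a ^ 2) * (x ^ 2 + C ^ 2))) := by
  refine aux_int C a ha hC 4 1 (fun x => ?_) (fun x => by positivity) (by norm_num)
  have : 0 ≤ a ^ 2 * x ^ 2 + x ^ 2 * C ^ 2 + a ^ 2 * C ^ 2 := by positivity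
  nlinarith

open MeasureTheory in
theorem aux_int2 (C a : ℝ) (ha : 0 < a) (hC : 0 ≤ C) :
    Integrable (fun x : ℝ => Real.exp (-x ^ 2 / 4) * x ^ 2 / ((x ^ 2 + a ^ 2) * (x ^ 2 + C ^ 2))) := by
  refine aux_int C a ha hC 2 (1 / a ^ 2) (fun x => ?_) (fun x => by positivity) (by positivity)
  rw [div_mul_eq_mul_div, le_div_iff₀ (by positivity)]
  have : 0 ≤ x ^ 2 * x ^ 2 + x ^ 2 * C ^ 2 + a ^ 2 * C ^ 2 := by positivity
  nlinarith

open MeasureTheory in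
theorem aux_pos (f : ℝ → ℝ) (hf : Integrable f) (h0 : ∀ x, 0 ≤ f x) (c : ℝ)
    (hc : ∀ x, c < x → f x ≠ 0) : 0 < ∫ x, f x := by
  rw [integral_pos_iff_support_of_nonneg h0 hf]
  refine lt_of_lt_of_le ?_ (measure_mono (s := Set.Ioi c) (fun x hx => hc x hx))
  simp

/-- For every fixed `C̃ ≥ 0`, the function `Ã ↦ F(Ã,C̃)` is strictly increasing on `(0,∞)`. -/
theorem stmt9 (C : ℝ) (hC : 0 ≤ C) :
    ∀ A₁ A₂ : ℝ, 0 < A₁ → A₁ < A₂ → Fint A₁ C < Fint A₂ C := by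
  intro a b ha hab
  have hb : 0 < b := ha.trans hab
  have iN1 := aux_int4 C a ha hC
  have iD1 := aux_int2 C a ha hC
  have iN2 := aux_int4 C b hb hC
  have iD2 := aux_int2 C b hb hC
  have pD : ∀ c : ℝ, 0 < c → 0 < ∫ x : ℝ, Real.exp (-x ^ 2 / 4) * x ^ 2 / ((x ^ 2 + c ^ 2) * (x ^ 2 + C ^ 2)) := by
    intro c hc
    refine aux_pos _ (aux_int2 C c hc hC) (fun x => by positivity) 0 (fun x hx => ?_)
    positivity
  have D1 := pD a ha
  have D2 := pD b hb
  have N1 : 0 ≤ ∫ x : ℝ, Real.exp (-x ^ 2 / 4) * x ^ 4 / ((x ^ 2 + a ^ 2) * (x ^ 2 + C ^ 2)) :=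
    MeasureTheory.integral_nonneg (fun x => by positivity)
  unfold Fint
  obtain ⟨m, hm⟩ : ∃ m, m = (∫ x : ℝ, Real.exp (-x ^ 2 / 4) * x ^ 4 / ((x ^ 2 + a ^ 2) * (x ^ 2 + C ^ 2))) /
    ∫ x : ℝ, Real.exp (-x ^ 2 / 4) * x ^ 2 / ((x ^ 2 + a ^ 2) * (x ^ 2 + C ^ 2)) := ⟨_, rfl⟩
  have hm0 : 0 ≤ m := by rw [hm]; positivity
  have hba : 0 < b ^ 2 - a ^ 2 := by nlinarith
  rw [mul_div_assoc, mul_div_assoc, ← hm]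
  rw [eq_div_iff D1.ne'] at hm
  refine mul_lt_mul_of_pos_left ?_ (by norm_num)
  rw [lt_div_iff₀ D2, ← sub_pos]
  have key : ∀ x : ℝ, Real.exp (-x ^ 2 / 4) * x ^ 2 * (x ^ 2 - m) ^ 2 * (b ^ 2 - a ^ 2) / ((x ^ 2 + a ^ 2) * (x ^ 2 + b ^ 2) * (x ^ 2 + C ^ 2) * (m + b ^ 2))
      = (Real.exp (-x ^ 2 / 4) * x ^ 4 / ((x ^ 2 + b ^ 2) * (x ^ 2 + C ^ 2))
        - m * (Real.exp (-x ^ 2 / 4) * x ^ 2 / ((x ^ 2 + b ^ 2) * (x ^ 2 + C ^ 2))))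
        - (m + a ^ 2) / (m + b ^ 2) * (Real.exp (-x ^ 2 / 4) * x ^ 4 / ((x ^ 2 + a ^ 2) * (x ^ 2 + C ^ 2))
        - m * (Real.exp (-x ^ 2 / 4) * x ^ 2 / ((x ^ 2 + a ^ 2) * (x ^ 2 + C ^ 2)))) := by
    intro x
    by_cases hx : x = 0
    · simp [hx]
    have h1 : x ^ 2 + a ^ 2 ≠ 0 := by positivity
    have h2 : x ^ 2 + b ^ 2 ≠ 0 := by positivity
    have h3 : x ^ 2 + C ^ 2 ≠ 0 := by positivity
    have h4 : m + b ^ 2 ≠ 0 := by positivity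
    generalize Real.exp (-x ^ 2 / 4) = e
    field_simp
    ring
  have i2 := iN2.sub (iD2.const_mul m)
  have i1 := (iN1.sub (iD1.const_mul m)).const_mul ((m + a ^ 2) / (m + b ^ 2))
  have iT := (i2.sub i1).congr (Filter.Eventually.of_forall fun x => (key x).symm)
  have pT := aux_pos _ iT (fun x => by positivity) (m + 1) (fun x hx => by
    have hx0 : 0 < x := by linarith
    have : x ^ 2 - m ≠ 0 := by
      have : 0 < x ^ 2 - m := by nlinarith
      exact this.ne'
    have := hba.ne'
    positivity)
  have e1 := MeasureTheory.integral_sub i2 i1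
  simp only [Pi.sub_apply] at e1
  simp only [key] at pT
  rw [e1, MeasureTheory.integral_const_mul, MeasureTheory.integral_sub iN2 (iD2.const_mul m),
    MeasureTheory.integral_sub iN1 (iD1.const_mul m), MeasureTheory.integral_const_mul, MeasureTheory.integral_const_mul, hm] at pT
  simpa using pT
end

section
/- Fix ψ > 0 and C̃ > 0. There exists A₀ > 0 such that for every Ã ≥ A₀ the function a ↦ F̃(a, C̃) is differentiable at Ã and its derivative there is strictly positive: d F̃(Ã,C̃)/dÃ > 0. -/
/-- `H(Ã,C̃;x) = Γ((Ã+ix)/ψ)Γ((Ã−ix)/ψ)Γ((C̃+ix)/ψ)Γ((C̃−ix)/ψ) / (Γ(2ix/ψ)Γ(−2ix/ψ))`. -/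
noncomputable def Hfun (ψ A C x : ℝ) : ℂ :=
  Complex.Gamma (((A : ℂ) + x * Complex.I) / (ψ : ℂ)) *
      Complex.Gamma (((A : ℂ) - x * Complex.I) / (ψ : ℂ)) *
      Complex.Gamma (((C : ℂ) + x * Complex.I) / (ψ : ℂ)) *
      Complex.Gamma (((C : ℂ) - x * Complex.I) / (ψ : ℂ)) /
    (Complex.Gamma (2 * (x : ℂ) * Complex.I / (ψ : ℂ)) *
      Complex.Gamma (-(2 * (x : ℂ) * Complex.I) / (ψ : ℂ)))

/-- `F̃(Ã,C̃) = (1/4)·(∫ e^{-x²/4} x² H(Ã,C̃;x) dx)/(∫ e^{-x²/4} H(Ã,C̃;x) dx)`. -/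
noncomputable def Ftilde (ψ A C : ℝ) : ℝ :=
  (1 / 4) * (∫ x : ℝ, Real.exp (-x ^ 2 / 4) * x ^ 2 * (Hfun ψ A C x).re) /
    ∫ x : ℝ, Real.exp (-x ^ 2 / 4) * (Hfun ψ A C x).re

open MeasureTheory Filter Topology

namespace Stmt12Aux

noncomputable def lg (s t : ℝ) : ℝ := ∑' n : ℕ, Real.log (1 + t / (s + n) ^ 2)

noncomputable def dd (s t : ℝ) : ℝ := ∑' n : ℕ, 2 * t / ((s + n) * ((s + n) ^ 2 + t))

noncomputable def E (s t : ℝ) : ℝ := Real.exp (-lg s t)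

lemma summable_sq (s : ℝ) (hs : 0 < s) : Summable (fun n : ℕ => 1 / (s + n) ^ 2) := by
  have h : Summable (fun n : ℕ => 1 / ((n : ℝ)) ^ 2) :=
    Real.summable_one_div_nat_pow.mpr (by norm_num)
  rw [← summable_nat_add_iff 1] at h ⊢
  refine Summable.of_nonneg_of_le (fun n => by positivity) (fun n => ?_) h
  push_cast
  apply one_div_le_one_div_of_le (by positivity)
  have hn : (0 : ℝ) ≤ n := Nat.cast_nonneg n
  apply pow_le_pow_left₀ (by positivity)
  linarith

lemma summable_log (s t : ℝ) (hs : 0 < s) :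
    Summable (fun n : ℕ => Real.log (1 + t / (s + n) ^ 2)) := by
  apply Real.summable_log_one_add_of_summable
  have := (summable_sq s hs).mul_left t
  exact this.congr fun n => by rw [mul_one_div]

lemma term_nonneg (s t : ℝ) (hs : 0 < s) (ht : 0 ≤ t) (n : ℕ) :
    0 ≤ 2 * t / ((s + n) * ((s + n) ^ 2 + t)) := by positivity

lemma term_le (s t : ℝ) (hs : 1 < s) (ht : 0 ≤ t) (n : ℕ) :
    2 * t / ((s + n) * ((s + n) ^ 2 + t)) ≤ 2 * t * (1 / (1 + (n : ℝ)) ^ 2) := by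
  rw [mul_one_div]
  have hn : (0 : ℝ) ≤ n := Nat.cast_nonneg n
  apply div_le_div_of_nonneg_left (by positivity) (by positivity)
  nlinarith [sq_nonneg (s + n), mul_nonneg hn hn, mul_nonneg (by linarith : 0 ≤ s - 1) hn,
    mul_nonneg (by linarith : 0 ≤ s + n) ht,
    mul_nonneg (by linarith : 0 ≤ s + n - 1) (sq_nonneg (s + n))]

noncomputable def KK : ℝ := ∑' n : ℕ, 2 * (1 / (1 + (n : ℝ)) ^ 2)

lemma summable_bd (t : ℝ) : Summable (fun n : ℕ => 2 * t * (1 / (1 + (n : ℝ)) ^ 2)) :=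
  (summable_sq 1 one_pos).mul_left _

lemma summable_dd (s t : ℝ) (hs : 1 < s) (ht : 0 ≤ t) :
    Summable (fun n : ℕ => 2 * t / ((s + n) * ((s + n) ^ 2 + t))) :=
  Summable.of_nonneg_of_le (term_nonneg s t (by linarith) ht) (term_le s t hs ht) (summable_bd t)

lemma dd_nonneg (s t : ℝ) (hs : 1 < s) (ht : 0 ≤ t) : 0 ≤ dd s t :=
  tsum_nonneg (term_nonneg s t (by linarith) ht)

lemma dd_le (s t : ℝ) (hs : 1 < s) (ht : 0 ≤ t) : dd s t ≤ KK * t := by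
  have h := (summable_dd s t hs ht).tsum_le_tsum (term_le s t hs ht) (summable_bd t)
  have h2 : ∑' n : ℕ, 2 * t * (1 / (1 + (n : ℝ)) ^ 2) = KK * t := by
    rw [KK, ← tsum_mul_right]
    exact tsum_congr fun n => by ring
  rw [h2] at h
  exact h

lemma term_lt (s t u : ℝ) (hs : 0 < s) (ht : 0 ≤ t) (htu : t < u) (n : ℕ) :
    2 * t / ((s + n) * ((s + n) ^ 2 + t)) < 2 * u / ((s + n) * ((s + n) ^ 2 + u)) := by
  have hn : (0 : ℝ) ≤ n := Nat.cast_nonneg n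
  have hp : 0 < s + n := by linarith
  have hu : 0 < u := by linarith
  rw [div_lt_div_iff₀ (by positivity) (by positivity)]
  have : 0 < (s + n) * (s + n) ^ 2 * (u - t) := mul_pos (by positivity) (by linarith)
  nlinarith

lemma dd_lt (s t u : ℝ) (hs : 1 < s) (ht : 0 ≤ t) (htu : t < u) : dd s t < dd s u :=
  Summable.tsum_lt_tsum (i := 0) (fun n => (term_lt s t u (by linarith) ht htu n).le)
    (term_lt s t u (by linarith) ht htu 0)
    (summable_dd s t hs ht) (summable_dd s u hs (by linarith))

lemma lg_nonneg (s t : ℝ) (ht : 0 ≤ t) : 0 ≤ lg s t :=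
  tsum_nonneg fun n => Real.log_nonneg (by
    have : 0 ≤ t / (s + n) ^ 2 := by positivity
    linarith)

lemma E_pos (s t : ℝ) : 0 < E s t := Real.exp_pos _

lemma E_le (s t : ℝ) (ht : 0 ≤ t) : E s t ≤ 1 := by
  rw [E, Real.exp_le_one_iff]
  linarith [lg_nonneg s t ht]

lemma hasDeriv_lg (s t : ℝ) (hs : 1 < s) (ht : 0 ≤ t) :
    HasDerivAt (fun s => lg s t) (-dd s t) s := by
  have := hasDerivAt_tsum_of_isPreconnected (t := Set.Ioi (1 : ℝ)) (y₀ := s) (y := s)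
    (g := fun (n : ℕ) s => Real.log (1 + t / (s + n) ^ 2))
    (g' := fun (n : ℕ) s => -(2 * t / ((s + n) * ((s + n) ^ 2 + t))))
    (summable_bd t) isOpen_Ioi isPreconnected_Ioi ?_ ?_ hs (summable_log s t (by linarith)) hs
  · rw [tsum_neg] at this
    exact this
  · intro n y hy
    have hy : 1 < y := hy
    have hp : 0 < y + n := by positivity
    have h1 : HasDerivAt (fun s : ℝ => (s + n) ^ 2) (2 * (y + n)) y := by
      have h0 := ((hasDerivAt_id' y).add_const (n : ℝ)).fun_pow 2
      simpa using h0
    have h2 := (((hasDerivAt_const y t).fun_div h1 (by positivity)).const_add 1).log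
      (by have : 0 ≤ t / (y + n) ^ 2 := by positivity
          positivity)
    refine h2.congr_deriv ?_
    have hq : 0 < (y + n) ^ 2 + t := by positivity
    field_simp
    ring
  · intro n y hy
    have hy : 1 < y := hy
    rw [norm_neg, Real.norm_of_nonneg (term_nonneg y t (by linarith) ht n)]
    exact term_le y t hy ht n

lemma hasDeriv_E (s t : ℝ) (hs : 1 < s) (ht : 0 ≤ t) :
    HasDerivAt (fun s => E s t) (E s t * dd s t) s := by
  have := (hasDeriv_lg s t hs ht).neg.exp
  simpa [E] using this

lemma meas_lg (s : ℝ) : Measurable (fun t => lg s t) :=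
  Measurable.tsum fun n => by fun_prop

lemma meas_dd (s : ℝ) : Measurable (fun t => dd s t) :=
  Measurable.tsum fun n => by fun_prop

lemma meas_E (s : ℝ) : Measurable (fun t => E s t) := (meas_lg s).neg.exp

lemma gamma_prod (s y : ℝ) (hs : 0 < s) :
    Complex.Gamma ((s : ℂ) + y * Complex.I) * Complex.Gamma ((s : ℂ) - y * Complex.I)
      = ((Real.Gamma s ^ 2 * E s (y ^ 2) : ℝ) : ℂ) := by
  have h1 := (Complex.GammaSeq_tendsto_Gamma ((s : ℂ) + y * Complex.I)).mul
    (Complex.GammaSeq_tendsto_Gamma ((s : ℂ) - y * Complex.I))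
  have h2 : Tendsto (fun n : ℕ => Real.GammaSeq s n ^ 2 *
      Real.exp (-∑ j ∈ Finset.range (n + 1), Real.log (1 + y ^ 2 / (s + j) ^ 2))) atTop
      (𝓝 (Real.Gamma s ^ 2 * E s (y ^ 2))) := by
    refine ((Real.GammaSeq_tendsto_Gamma s).pow 2).mul ?_
    refine (Real.continuous_exp.tendsto _).comp (Tendsto.neg ?_)
    exact ((summable_log s (y ^ 2) hs).hasSum.tendsto_sum_nat).comp (tendsto_add_atTop_nat 1)
  have h3 := (Complex.continuous_ofReal.tendsto _).comp h2
  refine tendsto_nhds_unique h1 (h3.congr' ?_)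
  filter_upwards [eventually_ne_atTop 0] with n hn
  have hn' : (n : ℂ) ≠ 0 := Nat.cast_ne_zero.mpr hn
  have hpw : (n : ℂ) ^ ((s : ℂ) + y * Complex.I) * (n : ℂ) ^ ((s : ℂ) - y * Complex.I)
      = ((n : ℂ) ^ (s : ℂ)) ^ 2 := by
    rw [← Complex.cpow_add _ _ hn', sq, ← Complex.cpow_add _ _ hn']
    congr 1
    ring
  have hE : Real.exp (-∑ j ∈ Finset.range (n + 1), Real.log (1 + y ^ 2 / (s + j) ^ 2))
      = ∏ j ∈ Finset.range (n + 1), ((s + j) ^ 2 / ((s + j) ^ 2 + y ^ 2)) := by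
    rw [← Finset.sum_neg_distrib, Real.exp_sum]
    refine Finset.prod_congr rfl fun j _ => ?_
    have hp : 0 < s + j := by positivity
    rw [Real.exp_neg, Real.exp_log (by positivity)]
    field_simp
  simp only [Function.comp_apply]
  rw [hE, Real.GammaSeq, Complex.GammaSeq, Complex.GammaSeq, div_mul_div_comm,
    mul_mul_mul_comm, hpw, ← Finset.prod_mul_distrib]
  rw [Finset.prod_div_distrib, Finset.prod_pow]
  have hprod : ∏ j ∈ Finset.range (n + 1), ((s : ℂ) + y * Complex.I + j) * (s - y * Complex.I + j)
      = ((∏ j ∈ Finset.range (n + 1), ((s + j) ^ 2 + y ^ 2) : ℝ) : ℂ) := by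
    push_cast
    refine Finset.prod_congr rfl fun j _ => ?_
    linear_combination (-(y : ℂ) ^ 2) * Complex.I_sq
  rw [hprod]
  have hq : (∏ j ∈ Finset.range (n + 1), (s + (j : ℝ))) ≠ 0 :=
    (Finset.prod_pos fun j _ => by positivity).ne'
  have hc : (n : ℂ) ^ (s : ℂ) = (((n : ℝ) ^ s : ℝ) : ℂ) := by
    rw [Complex.ofReal_cpow (by positivity)]
    simp
  rw [hc]
  rw [show (((n : ℝ) ^ s * (n.factorial : ℝ) / ∏ j ∈ Finset.range (n + 1), (s + (j : ℝ))) ^ 2 *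
      ((∏ j ∈ Finset.range (n + 1), (s + (j : ℝ))) ^ 2 /
        ∏ j ∈ Finset.range (n + 1), ((s + (j : ℝ)) ^ 2 + y ^ 2)))
      = ((n : ℝ) ^ s) ^ 2 * (n.factorial * n.factorial) /
        ∏ j ∈ Finset.range (n + 1), ((s + (j : ℝ)) ^ 2 + y ^ 2) by field_simp]
  push_cast
  rfl

lemma gamma_refl (y : ℝ) :
    1 / (Complex.Gamma (y * Complex.I) * Complex.Gamma (-(y * Complex.I)))
      = ((y * Real.sinh (Real.pi * y) / Real.pi : ℝ) : ℂ) := by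
  by_cases hy : y = 0
  · simp [hy]
  have hyI : -((y : ℂ) * Complex.I) ≠ 0 := by simp [hy]
  have h := Complex.Gamma_mul_Gamma_one_sub ((y : ℂ) * Complex.I)
  have h2 := Complex.Gamma_add_one (-((y : ℂ) * Complex.I)) hyI
  have hsin : Complex.sin (Real.pi * (y * Complex.I))
      = ((Real.sinh (Real.pi * y) : ℝ) : ℂ) * Complex.I := by
    rw [← mul_assoc, Complex.sin_mul_I]
    push_cast
    rfl
  rw [show (1 : ℂ) - y * Complex.I = -((y : ℂ) * Complex.I) + 1 by ring, h2, hsin] at h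
  have hsh : (Real.sinh (Real.pi * y)) ≠ 0 := by
    rw [Ne, Real.sinh_eq_zero]
    exact mul_ne_zero Real.pi_ne_zero hy
  have hsh' : ((Real.sinh (Real.pi * y) : ℝ) : ℂ) ≠ 0 := Complex.ofReal_ne_zero.mpr hsh
  have hpi : (Real.pi : ℂ) ≠ 0 := Complex.ofReal_ne_zero.mpr Real.pi_ne_zero
  have hyc : (y : ℂ) ≠ 0 := Complex.ofReal_ne_zero.mpr hy
  have h3 : Complex.Gamma (y * Complex.I) * Complex.Gamma (-(y * Complex.I))
      = Real.pi / (y * ((Real.sinh (Real.pi * y) : ℝ) : ℂ)) := by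
    have hI := Complex.I_ne_zero
    have h4 : -(y * Complex.I) *
        (Complex.Gamma (y * Complex.I) * Complex.Gamma (-(y * Complex.I)))
        = Real.pi / (((Real.sinh (Real.pi * y) : ℝ) : ℂ) * Complex.I) := by
      rw [← h]; ring
    apply mul_left_cancel₀ hyI
    rw [h4]
    field_simp
    rw [Complex.I_sq]
    ring
  rw [h3, one_div_div]
  push_cast
  rfl

/-- the weight -/
noncomputable def wt (ψ C x : ℝ) : ℝ :=
  Real.exp (-x ^ 2 / 4) * (Real.Gamma (C / ψ) ^ 2 * E (C / ψ) ((x / ψ) ^ 2)) *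
    ((2 * x / ψ) * Real.sinh (Real.pi * (2 * x / ψ)) / Real.pi)

lemma H_re (ψ A C x : ℝ) (hψ : 0 < ψ) (hA : 0 < A) (hC : 0 < C) :
    Real.exp (-x ^ 2 / 4) * (Hfun ψ A C x).re
      = Real.Gamma (A / ψ) ^ 2 * (E (A / ψ) ((x / ψ) ^ 2) * wt ψ C x) := by
  have e1 : ∀ B : ℝ, ((B : ℂ) + x * Complex.I) / (ψ : ℂ)
      = ((B / ψ : ℝ) : ℂ) + ((x / ψ : ℝ) : ℂ) * Complex.I := by
    intro B; push_cast; ring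
  have e2 : ∀ B : ℝ, ((B : ℂ) - x * Complex.I) / (ψ : ℂ)
      = ((B / ψ : ℝ) : ℂ) - ((x / ψ : ℝ) : ℂ) * Complex.I := by
    intro B; push_cast; ring
  have e3 : 2 * (x : ℂ) * Complex.I / (ψ : ℂ) = ((2 * x / ψ : ℝ) : ℂ) * Complex.I := by
    push_cast; ring
  have e4 : -(2 * (x : ℂ) * Complex.I) / (ψ : ℂ) = -(((2 * x / ψ : ℝ) : ℂ) * Complex.I) := by
    push_cast; ring
  have hH : Hfun ψ A C x = ((Real.Gamma (A / ψ) ^ 2 * E (A / ψ) ((x / ψ) ^ 2) *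
      (Real.Gamma (C / ψ) ^ 2 * E (C / ψ) ((x / ψ) ^ 2)) *
      ((2 * x / ψ) * Real.sinh (Real.pi * (2 * x / ψ)) / Real.pi) : ℝ) : ℂ) := by
    rw [Hfun, e1, e2, e1, e2, e3, e4, mul_assoc (_ * _), gamma_prod _ _ (div_pos hA hψ),
      gamma_prod _ _ (div_pos hC hψ), div_eq_mul_one_div, gamma_refl]
    push_cast
    rfl
  rw [hH, Complex.ofReal_re, wt]
  ring


lemma meas_wt (ψ C : ℝ) : Measurable (fun x => wt ψ C x) := by
  have h : Measurable (fun x : ℝ => E (C / ψ) ((x / ψ) ^ 2)) :=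
    (meas_E (C / ψ)).comp (by fun_prop)
  unfold wt
  fun_prop

lemma mul_sinh_nonneg (y : ℝ) : 0 ≤ y * Real.sinh (Real.pi * y) / Real.pi := by
  apply div_nonneg _ Real.pi_pos.le
  rcases le_total 0 y with h | h
  · exact mul_nonneg h (Real.sinh_nonneg_iff.mpr (by positivity))
  · exact mul_nonneg_of_nonpos_of_nonpos h
      (Real.sinh_nonpos_iff.mpr (mul_nonpos_of_nonneg_of_nonpos Real.pi_pos.le h))

lemma wt_nonneg (ψ C x : ℝ) : 0 ≤ wt ψ C x := by
  have := E_pos (C / ψ) ((x / ψ) ^ 2)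
  exact mul_nonneg (by positivity) (mul_sinh_nonneg _)

lemma wt_pos (ψ C x : ℝ) (hψ : 0 < ψ) (hC : 0 < C) (hx : x ≠ 0) : 0 < wt ψ C x := by
  refine lt_of_le_of_ne (wt_nonneg ψ C x) (Ne.symm ?_)
  have h1 := E_pos (C / ψ) ((x / ψ) ^ 2)
  have h2 := Real.Gamma_pos_of_pos (div_pos hC hψ)
  have h3 : 2 * x / ψ ≠ 0 := by positivity
  have h4 : Real.sinh (Real.pi * (2 * x / ψ)) ≠ 0 := by
    rw [Ne, Real.sinh_eq_zero]
    exact mul_ne_zero Real.pi_ne_zero h3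
  unfold wt
  have := Real.pi_ne_zero
  positivity

lemma mul_sinh_le (y : ℝ) :
    y * Real.sinh (Real.pi * y) / Real.pi ≤ Real.exp ((Real.pi + 1) * |y|) := by
  have h0 : y * Real.sinh (Real.pi * y) = |y| * Real.sinh (Real.pi * |y|) := by
    rcases abs_choice y with h | h <;> rw [h]
    rw [mul_neg, Real.sinh_neg]
    ring
  rw [h0]
  have h1 : Real.sinh (Real.pi * |y|) ≤ Real.exp (Real.pi * |y|) := by
    rw [Real.sinh_eq]
    have := Real.exp_pos (Real.pi * |y|)
    have := Real.exp_pos (-(Real.pi * |y|))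
    linarith
  have h2 : |y| ≤ Real.exp |y| := by linarith [Real.add_one_le_exp |y|]
  have h3 : |y| * Real.sinh (Real.pi * |y|) ≤ Real.exp ((Real.pi + 1) * |y|) := by
    calc |y| * Real.sinh (Real.pi * |y|) ≤ |y| * Real.exp (Real.pi * |y|) := by gcongr
      _ ≤ Real.exp |y| * Real.exp (Real.pi * |y|) := by gcongr
      _ = _ := by rw [← Real.exp_add]; ring_nf
  rw [div_le_iff₀ Real.pi_pos]
  nlinarith [Real.exp_pos ((Real.pi + 1) * |y|), Real.pi_gt_three]

lemma wt_le (ψ C : ℝ) (hψ : 0 < ψ) : ∃ M : ℝ, 0 ≤ M ∧ ∀ x, wt ψ C x ≤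
    M * Real.exp (-(1 / 8) * x ^ 2) := by
  set c : ℝ := (Real.pi + 1) * (2 / ψ) with hc
  refine ⟨Real.Gamma (C / ψ) ^ 2 * Real.exp (2 * c ^ 2), by positivity, fun x => ?_⟩
  have h1 := E_pos (C / ψ) ((x / ψ) ^ 2)
  have h2 := E_le (C / ψ) ((x / ψ) ^ 2) (by positivity)
  have h3 : (Real.pi + 1) * |2 * x / ψ| = c * |x| := by
    rw [abs_div, abs_mul, abs_of_pos hψ, hc, abs_of_pos (by norm_num : (0:ℝ) < 2)]
    ring
  have h4 := mul_sinh_le (2 * x / ψ)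
  rw [h3] at h4
  have h5 : c * |x| ≤ x ^ 2 / 8 + 2 * c ^ 2 := by
    rw [← sq_abs x]
    nlinarith [sq_nonneg (|x| - 4 * c)]
  have h6 := h4.trans (Real.exp_le_exp.mpr h5)
  calc wt ψ C x ≤ Real.exp (-x ^ 2 / 4) * (Real.Gamma (C / ψ) ^ 2 * 1) *
        Real.exp (x ^ 2 / 8 + 2 * c ^ 2) := by
        unfold wt
        have := mul_sinh_nonneg (2 * x / ψ)
        gcongr
    _ = Real.Gamma (C / ψ) ^ 2 * (Real.exp (-x ^ 2 / 4) * Real.exp (x ^ 2 / 8 + 2 * c ^ 2)) := by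
        ring
    _ = _ := by
        rw [mul_assoc, ← Real.exp_add, ← Real.exp_add]
        congr 2
        ring

lemma int_wt (ψ C : ℝ) (hψ : 0 < ψ) (k : ℕ) : Integrable (fun x => x ^ (2 * k) * wt ψ C x) := by
  obtain ⟨M, hM, h⟩ := wt_le ψ C hψ
  have h1 := (integrable_rpow_mul_exp_neg_mul_sq (b := 1 / 8) (by norm_num)
    (s := ((2 * k : ℕ) : ℝ)) (by have := Nat.cast_nonneg (α := ℝ) (2 * k); linarith)).const_mul M
  refine h1.mono' ?_ (Eventually.of_forall fun x => ?_)
  · have := meas_wt ψ C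
    exact (by fun_prop : Measurable fun x => x ^ (2 * k) * wt ψ C x).aestronglyMeasurable
  · have hp : 0 ≤ x ^ (2 * k) := by rw [pow_mul]; positivity
    rw [Real.norm_of_nonneg (mul_nonneg hp (wt_nonneg ψ C x)), Real.rpow_natCast]
    calc _ ≤ x ^ (2 * k) * (M * Real.exp (-(1 / 8) * x ^ 2)) := by gcongr; exact h x
      _ = _ := by ring

/-- moments -/
lemma mom_deriv (ψ C : ℝ) (hψ : 0 < ψ) (k : ℕ) (s : ℝ) (hs : 1 < s) :
    Integrable (fun x => x ^ (2 * k) * (E s ((x / ψ) ^ 2) * wt ψ C x)) ∧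
    Integrable (fun x => x ^ (2 * k) * (E s ((x / ψ) ^ 2) * dd s ((x / ψ) ^ 2) * wt ψ C x)) ∧
    HasDerivAt (fun s => ∫ x, x ^ (2 * k) * (E s ((x / ψ) ^ 2) * wt ψ C x))
      (∫ x, x ^ (2 * k) * (E s ((x / ψ) ^ 2) * dd s ((x / ψ) ^ 2) * wt ψ C x)) s := by
  have hw := meas_wt ψ C
  have hE : ∀ s, Measurable (fun x : ℝ => E s ((x / ψ) ^ 2)) :=
    fun s => (meas_E s).comp (by fun_prop)
  have hD : ∀ s, Measurable (fun x : ℝ => dd s ((x / ψ) ^ 2)) :=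
    fun s => (meas_dd s).comp (by fun_prop)
  have hp : ∀ x : ℝ, 0 ≤ x ^ (2 * k) := fun x => by rw [pow_mul]; positivity
  have hm1 : ∀ s, Measurable (fun x => x ^ (2 * k) * (E s ((x / ψ) ^ 2) * wt ψ C x)) := by
    intro s
    have := hE s
    fun_prop
  have hm2 : Measurable
      (fun x => x ^ (2 * k) * (E s ((x / ψ) ^ 2) * dd s ((x / ψ) ^ 2) * wt ψ C x)) := by
    have := hE s
    have := hD s
    fun_prop
  have hi1 : Integrable (fun x => x ^ (2 * k) * (E s ((x / ψ) ^ 2) * wt ψ C x)) := by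
    refine (int_wt ψ C hψ k).mono' (hm1 s).aestronglyMeasurable (Eventually.of_forall fun x => ?_)
    have h1 := E_pos s ((x / ψ) ^ 2)
    have h2 := E_le s ((x / ψ) ^ 2) (by positivity)
    have h3 := wt_nonneg ψ C x
    have h4 := hp x
    rw [Real.norm_of_nonneg (by positivity)]
    exact mul_le_mul_of_nonneg_left (mul_le_of_le_one_left h3 h2) h4
  refine ⟨hi1, ?_⟩
  refine hasDerivAt_integral_of_dominated_loc_of_deriv_le (s := Set.Ioi 1)
    (F := fun s x => x ^ (2 * k) * (E s ((x / ψ) ^ 2) * wt ψ C x))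
    (F' := fun s x => x ^ (2 * k) * (E s ((x / ψ) ^ 2) * dd s ((x / ψ) ^ 2) * wt ψ C x))
    (bound := fun x => KK / ψ ^ 2 * (x ^ (2 * (k + 1)) * wt ψ C x))
    (Ioi_mem_nhds hs) (Eventually.of_forall fun s => (hm1 s).aestronglyMeasurable) hi1
    hm2.aestronglyMeasurable (Eventually.of_forall fun x y hy => ?_)
    ((int_wt ψ C hψ (k + 1)).const_mul _) (Eventually.of_forall fun x y hy => ?_)
  · have h0 : 0 ≤ (x / ψ) ^ 2 := by positivity
    have h1 := E_pos y ((x / ψ) ^ 2)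
    have h2 := E_le y ((x / ψ) ^ 2) h0
    have h3 := wt_nonneg ψ C x
    have h4 := hp x
    have h5 := dd_nonneg y ((x / ψ) ^ 2) hy h0
    have h6 := dd_le y ((x / ψ) ^ 2) hy h0
    rw [Real.norm_of_nonneg (by positivity)]
    calc _ ≤ x ^ (2 * k) * (1 * (KK * (x / ψ) ^ 2) * wt ψ C x) := by gcongr
      _ = _ := by rw [div_pow]; ring
  · exact (((hasDeriv_E y ((x / ψ) ^ 2) hy (by positivity)).mul_const _).const_mul _)

lemma main_pos (ψ C : ℝ) (hψ : 0 < ψ) (hC : 0 < C) (s : ℝ) (hs : 1 < s) :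
    ∃ q : ℝ, 0 < q ∧ HasDerivAt
      (fun s => (∫ x, x ^ (2 * 1) * (E s ((x / ψ) ^ 2) * wt ψ C x)) /
        ∫ x, x ^ (2 * 0) * (E s ((x / ψ) ^ 2) * wt ψ C x)) q s := by
  obtain ⟨iN, iN', hN⟩ := mom_deriv ψ C hψ 1 s hs
  obtain ⟨iZ, iZ', hZ⟩ := mom_deriv ψ C hψ 0 s hs
  have key : ∀ (S : Set ℝ), S.Finite → ∀ f : ℝ → ℝ, Integrable f → (∀ x, 0 ≤ f x) →
      (∀ x, x ∉ S → f x ≠ 0) → 0 < ∫ x, f x := by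
    intro S hS f hf h0 hne
    rw [integral_pos_iff_support_of_nonneg h0 hf]
    have hsub : Sᶜ ⊆ Function.support f := fun x hx => hne x hx
    refine lt_of_lt_of_le ?_ (measure_mono hsub)
    rw [measure_compl hS.measurableSet (by simp [hS.measure_zero]), hS.measure_zero]
    simp
  have hEp := fun x : ℝ => E_pos s ((x / ψ) ^ 2)
  have hZp : 0 < ∫ x, x ^ (2 * 0) * (E s ((x / ψ) ^ 2) * wt ψ C x) := by
    refine key {0} (Set.finite_singleton 0) _ iZ (fun x => ?_) (fun x hx => ?_)
    · have := hEp x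
      have := wt_nonneg ψ C x
      simp only [mul_zero, pow_zero, one_mul]
      positivity
    · have := hEp x
      have := wt_pos ψ C x hψ hC hx
      simp only [mul_zero, pow_zero, one_mul]
      positivity
  have hNp : 0 ≤ ∫ x, x ^ (2 * 1) * (E s ((x / ψ) ^ 2) * wt ψ C x) := by
    refine integral_nonneg fun x => ?_
    have := hEp x
    have := wt_nonneg ψ C x
    simp only [mul_one]
    positivity
  have hdiv := hN.fun_div hZ hZp.ne'
  refine ⟨_, ?_, hdiv⟩
  set N := ∫ x, x ^ (2 * 1) * (E s ((x / ψ) ^ 2) * wt ψ C x) with hNdef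
  set Z := ∫ x, x ^ (2 * 0) * (E s ((x / ψ) ^ 2) * wt ψ C x) with hZdef
  set N' := ∫ x, x ^ (2 * 1) * (E s ((x / ψ) ^ 2) * dd s ((x / ψ) ^ 2) * wt ψ C x) with hN'def
  set Z' := ∫ x, x ^ (2 * 0) * (E s ((x / ψ) ^ 2) * dd s ((x / ψ) ^ 2) * wt ψ C x) with hZ'def
  set m := N / Z with hm
  have hm0 : 0 ≤ m := div_nonneg hNp hZp.le
  set d := dd s (m / ψ ^ 2) with hd
  have hNm : N = m * Z := by rw [hm]; field_simp
  have hint : ∫ x, ((x ^ (2 * 1) * (E s ((x / ψ) ^ 2) * dd s ((x / ψ) ^ 2) * wt ψ C x)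
      - m * (x ^ (2 * 0) * (E s ((x / ψ) ^ 2) * dd s ((x / ψ) ^ 2) * wt ψ C x)))
      - d * (x ^ (2 * 1) * (E s ((x / ψ) ^ 2) * wt ψ C x)
        - m * (x ^ (2 * 0) * (E s ((x / ψ) ^ 2) * wt ψ C x))))
      = (N' - m * Z') - d * (N - m * Z) := by
    have i1 := iZ'.const_mul m
    have i2 := iZ.const_mul m
    have i3 : Integrable (fun x => x ^ (2 * 1) *
        (E s ((x / ψ) ^ 2) * dd s ((x / ψ) ^ 2) * wt ψ C x)
        - m * (x ^ (2 * 0) * (E s ((x / ψ) ^ 2) * dd s ((x / ψ) ^ 2) * wt ψ C x))) := iN'.sub i1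
    have i4 : Integrable (fun x => x ^ (2 * 1) * (E s ((x / ψ) ^ 2) * wt ψ C x)
        - m * (x ^ (2 * 0) * (E s ((x / ψ) ^ 2) * wt ψ C x))) := iN.sub i2
    rw [integral_sub i3 (i4.const_mul d), integral_sub iN' i1,
      integral_const_mul, integral_const_mul, integral_sub iN i2, integral_const_mul]
  have hi : Integrable fun x => ((x ^ (2 * 1) * (E s ((x / ψ) ^ 2) * dd s ((x / ψ) ^ 2) * wt ψ C x)
      - m * (x ^ (2 * 0) * (E s ((x / ψ) ^ 2) * dd s ((x / ψ) ^ 2) * wt ψ C x)))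
      - d * (x ^ (2 * 1) * (E s ((x / ψ) ^ 2) * wt ψ C x)
        - m * (x ^ (2 * 0) * (E s ((x / ψ) ^ 2) * wt ψ C x)))) :=
    (iN'.sub (iZ'.const_mul m)).sub ((iN.sub (iZ.const_mul m)).const_mul d)
  have hfac : ∀ x, ((x ^ (2 * 1) * (E s ((x / ψ) ^ 2) * dd s ((x / ψ) ^ 2) * wt ψ C x)
      - m * (x ^ (2 * 0) * (E s ((x / ψ) ^ 2) * dd s ((x / ψ) ^ 2) * wt ψ C x)))
      - d * (x ^ (2 * 1) * (E s ((x / ψ) ^ 2) * wt ψ C x)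
        - m * (x ^ (2 * 0) * (E s ((x / ψ) ^ 2) * wt ψ C x))))
      = ((x ^ 2 - m) * (dd s ((x / ψ) ^ 2) - d)) * (E s ((x / ψ) ^ 2) * wt ψ C x) := by
    intro x; ring
  have hcov : ∀ x : ℝ, x ^ 2 ≠ m → 0 < (x ^ 2 - m) * (dd s ((x / ψ) ^ 2) - d) := by
    intro x hx
    rw [div_pow]
    rcases lt_or_gt_of_ne hx with h | h
    · have := dd_lt s (x ^ 2 / ψ ^ 2) (m / ψ ^ 2) hs (by positivity) (by gcongr)
      exact mul_pos_of_neg_of_neg (by linarith) (by linarith)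
    · have := dd_lt s (m / ψ ^ 2) (x ^ 2 / ψ ^ 2) hs (by positivity) (by gcongr)
      exact mul_pos (by linarith) (by linarith)
  have hpos : 0 < (N' - m * Z') - d * (N - m * Z) := by
    rw [← hint]
    refine key {0, √m, -√m} (by simp) _ hi (fun x => ?_) (fun x hx => ?_)
    · rw [hfac]
      have h1 := hEp x
      have h2 := wt_nonneg ψ C x
      by_cases hx : x ^ 2 = m
      · simp [hx]
      · have := hcov x hx
        positivity
    · rw [hfac]
      simp only [Set.mem_insert_iff, Set.mem_singleton_iff, not_or] at hx
      have h1 := hEp x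
      have h2 := wt_pos ψ C x hψ hC hx.1
      have h3 : x ^ 2 ≠ m := by
        intro h
        rw [← Real.sq_sqrt hm0, sq_eq_sq_iff_eq_or_eq_neg] at h
        tauto
      have := hcov x h3
      positivity
  apply div_pos _ (by positivity)
  have : N' * Z - N * Z' = Z * ((N' - m * Z') - d * (N - m * Z)) := by
    rw [hNm]; ring
  rw [this]
  exact mul_pos hZp hpos

lemma Ftilde_eq (ψ A C : ℝ) (hψ : 0 < ψ) (hA : 0 < A) (hC : 0 < C) :
    Ftilde ψ A C = 1 / 4 * ((∫ x, x ^ (2 * 1) * (E (A / ψ) ((x / ψ) ^ 2) * wt ψ C x)) /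
        ∫ x, x ^ (2 * 0) * (E (A / ψ) ((x / ψ) ^ 2) * wt ψ C x)) := by
  have hG := Real.Gamma_pos_of_pos (div_pos hA hψ)
  have h1 : ∀ x : ℝ, Real.exp (-x ^ 2 / 4) * x ^ 2 * (Hfun ψ A C x).re
      = Real.Gamma (A / ψ) ^ 2 * (x ^ (2 * 1) * (E (A / ψ) ((x / ψ) ^ 2) * wt ψ C x)) := by
    intro x
    have := H_re ψ A C x hψ hA hC
    linear_combination x ^ 2 * this
  have h0 : ∀ x : ℝ, Real.exp (-x ^ 2 / 4) * (Hfun ψ A C x).re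
      = Real.Gamma (A / ψ) ^ 2 * (x ^ (2 * 0) * (E (A / ψ) ((x / ψ) ^ 2) * wt ψ C x)) := by
    intro x
    have := H_re ψ A C x hψ hA hC
    linear_combination this
  unfold Ftilde
  simp_rw [h1, h0, integral_const_mul]
  rw [mul_div_assoc, mul_div_mul_left _ _ (by positivity)]

end Stmt12Aux

/-- For fixed `ψ > 0` and `C̃ > 0`, for all sufficiently large `Ã` the function
`a ↦ F̃(a,C̃)` is differentiable at `Ã` with strictly positive derivative. -/
theorem stmt12 (ψ C : ℝ) (hψ : 0 < ψ) (hC : 0 < C) :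
    ∃ A₀ > (0 : ℝ), ∀ A : ℝ, A₀ ≤ A →
      DifferentiableAt ℝ (fun a => Ftilde ψ a C) A ∧
        0 < deriv (fun a => Ftilde ψ a C) A := by
  refine ⟨2 * ψ, by positivity, fun A hA => ?_⟩
  have hs : 1 < A / ψ := by rw [lt_div_iff₀ hψ]; linarith
  have hA0 : 0 < A := by linarith
  obtain ⟨q, hq, hd⟩ := Stmt12Aux.main_pos ψ C hψ hC (A / ψ) hs
  have h1 := (HasDerivAt.comp A hd ((hasDerivAt_id' A).div_const ψ)).const_mul (1 / 4)
  have h2 : HasDerivAt (fun a => Ftilde ψ a C) (1 / 4 * (q * (1 / ψ))) A := by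
    refine h1.congr_of_eventuallyEq ?_
    filter_upwards [Ioi_mem_nhds hA0] with a ha
    exact Stmt12Aux.Ftilde_eq ψ a C hψ ha hC
  refine ⟨h2.differentiableAt, ?_⟩
  rw [h2.deriv]
  positivity
end

section
/- Let ψ > 0, κ ∈ [0, 1/2), Ã > 0, C̃ > 0, and B̃, D̃ ∈ ℝ. For each integer N ≥ 1 set q_N := exp(−ψ·N^{−κ}), A_N := exp(−Ã·N^{−1/2}), C_N := exp(−C̃·N^{−1/2}), B_N := −q_N·exp(−B̃·N^{−1/2}), D_N := −q_N·exp(−D̃·N^{−1/2}), and let I₀(N), I₁(N) be the integrals formed with these parameters (q_N, A_N, B_N, C_N, D_N). Then N · I₁(N)/I₀(N) → F(Ã,C̃) as N → ∞; equivalently, the stationary current satisfies J_N = ((1−q_N)/4)·(1 + F(Ã,C̃)/N + o(N^{−1})). -/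
/-- Infinite q-Pochhammer symbol `(x;q)_∞ = ∏_{k≥0} (1 - x qᵏ)`. -/
noncomputable def poch (x : ℂ) (q : ℝ) : ℂ := ∏' k : ℕ, (1 - x * (q : ℂ) ^ k)

/-- `g(z;q) = (z²,z⁻²;q)_∞ / ((Az,Az⁻¹;q)_∞ (Bz,Bz⁻¹;q)_∞ (Cz,Cz⁻¹;q)_∞ (Dz,Dz⁻¹;q)_∞)`. -/
noncomputable def gfun (q : ℝ) (A B C D z : ℂ) : ℂ :=
  poch (z ^ 2) q * poch (z⁻¹ ^ 2) q /
    (poch (A * z) q * poch (A * z⁻¹) q * (poch (B * z) q * poch (B * z⁻¹) q) *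
      (poch (C * z) q * poch (C * z⁻¹) q) * (poch (D * z) q * poch (D * z⁻¹) q))

/-- `I₀(N) = (1/(4π)) ∫_0^{2π} (2+2cos θ)^N g(e^{iθ};q) dθ`. -/
noncomputable def Iint0 (q : ℝ) (A B C D : ℂ) (N : ℕ) : ℂ :=
  ((1 / (4 * Real.pi) : ℝ) : ℂ) *
    ∫ θ in (0 : ℝ)..(2 * Real.pi),
      ((2 + 2 * Real.cos θ : ℝ) : ℂ) ^ N * gfun q A B C D (Complex.exp ((θ : ℂ) * Complex.I))

/-- `I₁(N) = (1/(4π)) ∫_0^{2π} (2+2cos θ)^N g(e^{iθ};q) (4/(2+2cos θ) - 1) dθ`. -/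
noncomputable def Iint1 (q : ℝ) (A B C D : ℂ) (N : ℕ) : ℂ :=
  ((1 / (4 * Real.pi) : ℝ) : ℂ) *
    ∫ θ in (0 : ℝ)..(2 * Real.pi),
      ((2 + 2 * Real.cos θ : ℝ) : ℂ) ^ N * gfun q A B C D (Complex.exp ((θ : ℂ) * Complex.I)) *
        (4 / ((2 + 2 * Real.cos θ : ℝ) : ℂ) - 1)

open Filter Topology MeasureTheory

noncomputable def Qf (q a c : ℝ) : ℝ := ∏' k : ℕ, (1 + (-2 * (a * q ^ k) * c + (a * q ^ k) ^ 2))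

lemma Q_summable {q : ℝ} (h0 : 0 < q) (h1 : q < 1) (a c : ℝ) :
    Summable (fun k : ℕ => -2 * (a * q ^ k) * c + (a * q ^ k) ^ 2) := by
  have s1 : Summable (fun k : ℕ => q ^ k) := summable_geometric_of_lt_one h0.le h1
  have s2 : Summable (fun k : ℕ => (q ^ 2) ^ k) :=
    summable_geometric_of_lt_one (by positivity) (by nlinarith)
  refine ((s1.mul_left (-2 * a * c)).add (s2.mul_left (a ^ 2))).congr ?_
  intro k
  ring

lemma Q_mult {q : ℝ} (h0 : 0 < q) (h1 : q < 1) (a c : ℝ) :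
    Multipliable (fun k : ℕ => 1 + (-2 * (a * q ^ k) * c + (a * q ^ k) ^ 2)) :=
  Real.multipliable_one_add_of_summable (Q_summable h0 h1 a c)

lemma Q_peel {q : ℝ} (h0 : 0 < q) (h1 : q < 1) (a c : ℝ) :
    Qf q a c = (1 - 2 * a * c + a ^ 2) * Qf q (a * q) c := by
  unfold Qf
  have := tprod_eq_zero_mul' (f := fun k : ℕ => 1 + (-2 * (a * q ^ k) * c + (a * q ^ k) ^ 2)) ?_
  · rw [this]
    congr 1
    · simp; ring
    · congr 1; ext k; ring
  · refine (Q_mult h0 h1 (a * q) c).congr ?_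
    intro k; ring

lemma Q_measurable {q : ℝ} (h0 : 0 < q) (h1 : q < 1) (a : ℝ) : Measurable (Qf q a) := by
  refine measurable_of_tendsto_metrizable
    (f := fun n c => ∏ k ∈ Finset.range n, (1 + (-2 * (a * q ^ k) * c + (a * q ^ k) ^ 2))) ?_ ?_
  · intro n
    exact Continuous.measurable (by fun_prop)
  · rw [tendsto_pi_nhds]
    intro c
    exact (Q_mult h0 h1 a c).hasProd.tendsto_prod_nat

lemma poch_mult {q : ℝ} (h0 : 0 < q) (h1 : q < 1) (x : ℂ) :
    Multipliable (fun k : ℕ => 1 - x * (q : ℂ) ^ k) := by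
  simp_rw [sub_eq_add_neg]
  apply multipliable_one_add_of_summable
  have s1 : Summable (fun k : ℕ => q ^ k) := summable_geometric_of_lt_one h0.le h1
  refine (s1.mul_left ‖x‖).congr ?_
  intro k
  simp [abs_of_pos h0]

lemma poch_pair {q : ℝ} (h0 : 0 < q) (h1 : q < 1) (a θ : ℝ) :
    poch (a * Complex.exp (θ * Complex.I)) q * poch (a * (Complex.exp (θ * Complex.I))⁻¹) q
      = ((Qf q a (Real.cos θ) : ℝ) : ℂ) := by
  unfold poch Qf
  rw [← (poch_mult h0 h1 _).tprod_mul (poch_mult h0 h1 _)]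
  have := (Q_mult h0 h1 a (Real.cos θ)).hasProd.map Complex.ofRealHom Complex.continuous_ofReal
  have h2 := this.tprod_eq
  rw [Complex.ofRealHom_eq_coe] at h2
  rw [← h2]
  congr 1; ext k
  simp only [Function.comp, Complex.ofRealHom_eq_coe]
  have e1 : Complex.exp (θ * Complex.I) * (Complex.exp (θ * Complex.I))⁻¹ = 1 :=
    mul_inv_cancel₀ (Complex.exp_ne_zero _)
  have e2 : Complex.exp (θ * Complex.I) + (Complex.exp (θ * Complex.I))⁻¹ = 2 * Complex.cos θ := by
    rw [← Complex.exp_neg, Complex.cos]; ring_nf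
  push_cast
  linear_combination (-(a * (q:ℂ)^k)) * e2 + (a * (q:ℂ)^k)^2 * e1

lemma gfun_eq {q : ℝ} (h0 : 0 < q) (h1 : q < 1) (A B C D θ : ℝ) :
    gfun q A B C D (Complex.exp (θ * Complex.I)) =
      ((Qf q 1 (Real.cos (2 * θ)) / (Qf q A (Real.cos θ) * Qf q B (Real.cos θ) *
        Qf q C (Real.cos θ) * Qf q D (Real.cos θ)) : ℝ) : ℂ) := by
  unfold gfun
  have hn := poch_pair h0 h1 1 (2 * θ)
  have : Complex.exp (((2 * θ : ℝ) : ℂ) * Complex.I) = Complex.exp (θ * Complex.I) ^ 2 := by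
    rw [← Complex.exp_nat_mul]; push_cast; ring_nf
  rw [this] at hn
  simp only [Complex.ofReal_one, one_mul] at hn
  rw [inv_pow, hn, poch_pair h0 h1, poch_pair h0 h1, poch_pair h0 h1, poch_pair h0 h1]
  push_cast
  ring

/-- comparison of products -/
lemma tprod_le_exp {f g : ℕ → ℝ} {m : ℕ → ℝ} (hf : Multipliable f) (hg : Multipliable g)
    (hm : Summable m) (hf0 : ∀ k, 0 ≤ f k) (hle : ∀ k, f k ≤ g k * Real.exp (m k)) :
    ∏' k, f k ≤ (∏' k, g k) * Real.exp (∑' k, m k) := by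
  refine le_of_tendsto_of_tendsto' hf.hasProd.tendsto_prod_nat
    (hg.hasProd.tendsto_prod_nat.mul
      ((Real.continuous_exp.tendsto _).comp hm.hasSum.tendsto_sum_nat)) ?_
  intro n
  simp only [Function.comp, Real.exp_sum, ← Finset.prod_mul_distrib]
  exact Finset.prod_le_prod (fun k _ => hf0 k) (fun k _ => hle k)

lemma tprod_le_tprod' {f g : ℕ → ℝ} (hf : Multipliable f) (hg : Multipliable g)
    (hf0 : ∀ k, 0 ≤ f k) (hle : ∀ k, f k ≤ g k) :
    ∏' k, f k ≤ (∏' k, g k) := by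
  simpa using tprod_le_exp (m := fun _ => 0) hf hg summable_zero hf0 (by simpa using hle)

noncomputable def Mc : ℝ := ∑' k : ℕ, 4 / ((k : ℝ) + 1) ^ 2

lemma Mc_summable : Summable (fun k : ℕ => 4 / ((k : ℝ) + 1) ^ 2) := by
  have := (summable_nat_add_iff 1).2 (Real.summable_one_div_nat_pow.2 (show 1 < 2 by norm_num))
  refine (this.mul_left 4).congr ?_
  intro k; push_cast; ring

lemma Mc_nonneg : 0 ≤ Mc := tsum_nonneg (fun k => by positivity)

lemma x_bound {t x : ℝ} (ht : 0 < t) (hx0 : 0 < x) (hx : x ≤ Real.exp (-t)) :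
    x < 1 ∧ x / (1 - x) ^ 2 ≤ 1 / t ^ 2 := by
  have hlt : x < 1 := hx.trans_lt (by simpa using ht)
  refine ⟨hlt, ?_⟩
  -- t ≤ 2 sinh (t/2)
  have hs : t / 2 ≤ Real.sinh (t / 2) := Real.self_le_sinh_iff.2 (by positivity)
  rw [Real.sinh_eq] at hs
  set y := Real.exp (-(t / 2)) with hy
  have hy0 : 0 < y := Real.exp_pos _
  have hyy : Real.exp (-t) = y ^ 2 := by rw [hy, ← Real.exp_nat_mul]; congr 1; push_cast; ring
  have hyi : Real.exp (t / 2) * y = 1 := by rw [hy, ← Real.exp_add]; simp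
  have h1 : t * y ≤ 1 - y ^ 2 := by nlinarith
  rw [hyy] at hx
  have hsq : (t * y) ^ 2 ≤ (1 - y ^ 2) ^ 2 := pow_le_pow_left₀ (by positivity) h1 2
  have h1x : 0 < 1 - x := by linarith
  rw [div_le_div_iff₀ (by positivity) (by positivity)]
  -- x t^2 ≤ (1-x)^2 ; x/(1-x)^2 increasing
  have h3 : x * (1 - y ^ 2) ^ 2 ≤ y ^ 2 * (1 - x) ^ 2 := by
    have hy1 : y ^ 2 < 1 := by nlinarith [mul_pos ht hy0]
    have : 0 ≤ (y ^ 2 - x) * (1 - x * y ^ 2) :=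
      mul_nonneg (by linarith) (by nlinarith)
    nlinarith
  have h4 : y ^ 2 * (x * t ^ 2) ≤ y ^ 2 * (1 - x) ^ 2 := by
    nlinarith
  have := le_of_mul_le_mul_left h4 (by positivity)
  linarith

lemma Q_bounds {ε a θ : ℝ} (hε : 0 < ε) (ha0 : 0 < a) (ha : a ≤ Real.exp (-(ε / 2))) :
    0 < Qf (Real.exp (-ε)) a 1 ∧ Qf (Real.exp (-ε)) a 1 ≤ Qf (Real.exp (-ε)) a (Real.cos θ) ∧
    Qf (Real.exp (-ε)) a (Real.cos θ) ≤ Qf (Real.exp (-ε)) a 1 * Real.exp (Mc * θ ^ 2 / ε ^ 2) ∧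
    0 < Qf (Real.exp (-ε)) (-a) 1 ∧ Qf (Real.exp (-ε)) (-a) (Real.cos θ) ≤ Qf (Real.exp (-ε)) (-a) 1 ∧
    Qf (Real.exp (-ε)) (-a) 1 ≤ Qf (Real.exp (-ε)) (-a) (Real.cos θ) * Real.exp (Mc * θ ^ 2 / ε ^ 2)
    := by
  set q := Real.exp (-ε) with hq
  have h0 : 0 < q := Real.exp_pos _
  have h1 : q < 1 := by rw [hq]; simpa using hε
  have hx0 : ∀ k : ℕ, 0 < a * q ^ k := fun k => by positivity
  have hxb : ∀ k : ℕ, a * q ^ k < 1 ∧ (a * q ^ k) / (1 - a * q ^ k) ^ 2 ≤ 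
      1 / (((k : ℝ) + 1) * ε / 2) ^ 2 := by
    intro k
    refine x_bound (by positivity) (hx0 k) ?_
    have : q ^ k = Real.exp (-(k * ε)) := by rw [hq, ← Real.exp_nat_mul]; ring_nf
    calc a * q ^ k ≤ Real.exp (-(ε / 2)) * Real.exp (-(k * ε)) := by rw [this]; gcongr
      _ = Real.exp (-(ε / 2) + -(k * ε)) := by rw [Real.exp_add]
      _ ≤ _ := by
        apply Real.exp_le_exp.2
        have : 0 ≤ (k : ℝ) * ε := by positivity
        linarith
  have hc : 1 - Real.cos θ ≤ θ ^ 2 / 2 := by linarith [Real.one_sub_sq_div_two_le_cos (x := θ)]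
  have hc0 : Real.cos θ ≤ 1 := Real.cos_le_one θ
  set c := Real.cos θ with hcd
  have hm : Summable (fun k : ℕ => (4 / ((k : ℝ) + 1) ^ 2) * (θ ^ 2 / ε ^ 2)) := Mc_summable.mul_right _
  have hmt : ∑' k : ℕ, (4 / ((k : ℝ) + 1) ^ 2) * (θ ^ 2 / ε ^ 2) = Mc * θ ^ 2 / ε ^ 2 := by
    rw [tsum_mul_right, Mc]; ring
  have hmk : ∀ k : ℕ, (a * q ^ k) / (1 - a * q ^ k) ^ 2 * θ ^ 2 ≤
      (4 / ((k : ℝ) + 1) ^ 2) * (θ ^ 2 / ε ^ 2) := by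
    intro k
    calc _ ≤ 1 / (((k : ℝ) + 1) * ε / 2) ^ 2 * θ ^ 2 := 
          mul_le_mul_of_nonneg_right (hxb k).2 (sq_nonneg θ)
      _ = _ := by field_simp; ring
  have pos : ∀ b : ℝ, (∀ k : ℕ, 1 - b * q ^ k ≠ 0) → 0 < Qf q b 1 := by
    intro b hb
    have hne : Qf q b 1 ≠ 0 := by
      refine tprod_one_add_ne_zero_of_summable (fun k => ?_) ((Q_summable h0 h1 b 1).abs)
      have := pow_ne_zero 2 (hb k)
      convert this using 1; ring
    refine lt_of_le_of_ne ?_ hne.symm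
    refine ge_of_tendsto' (Q_mult h0 h1 b 1).hasProd.tendsto_prod_nat (fun n => ?_)
    refine Finset.prod_nonneg (fun k _ => ?_)
    nlinarith [sq_nonneg (1 - b * q ^ k)]
  refine ⟨?_, ?_, ?_, ?_, ?_, ?_⟩
  · exact pos a (fun k => by linarith [(hxb k).1])
  · refine tprod_le_tprod' (Q_mult h0 h1 _ _) (Q_mult h0 h1 _ _) (fun k => ?_) (fun k => ?_)
    · nlinarith [sq_nonneg (1 - a * q ^ k)]
    · nlinarith [hx0 k]
  · rw [← hmt]
    refine tprod_le_exp (Q_mult h0 h1 _ _) (Q_mult h0 h1 _ _) hm (fun k => ?_) (fun k => ?_)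
    · nlinarith [sq_nonneg (1 - a * q ^ k), hx0 k]
    · have hx := hx0 k
      have hk := hmk k
      have hl := (hxb k).1
      set x := a * q ^ k
      have h1x : 0 < 1 - x := by linarith
      have he := Real.add_one_le_exp ((4 / ((k : ℝ) + 1) ^ 2) * (θ ^ 2 / ε ^ 2))
      calc 1 + (-2 * x * c + x ^ 2) ≤ (1 - x) ^ 2 + x * θ ^ 2 := by nlinarith
        _ = (1 - x) ^ 2 * (x / (1 - x) ^ 2 * θ ^ 2 + 1) := by field_simp; ring
        _ ≤ (1 - x) ^ 2 * Real.exp ((4 / ((k : ℝ) + 1) ^ 2) * (θ ^ 2 / ε ^ 2)) := by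
          gcongr; linarith
        _ = _ := by ring
  · exact pos (-a) (fun k => by have := hx0 k; rw [neg_mul]; linarith)
  · refine tprod_le_tprod' (Q_mult h0 h1 _ _) (Q_mult h0 h1 _ _) (fun k => ?_) (fun k => ?_)
    · nlinarith [sq_nonneg (1 - a * q ^ k), hx0 k, Real.neg_one_le_cos θ]
    · nlinarith [hx0 k]
  · rw [← hmt]
    refine tprod_le_exp (Q_mult h0 h1 _ _) (Q_mult h0 h1 _ _) hm (fun k => ?_) (fun k => ?_)
    · nlinarith [sq_nonneg (1 + a * q ^ k), hx0 k]
    · have hx := hx0 k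
      have hk := hmk k
      have hl := (hxb k).1
      rw [show -a * q ^ k = -(a * q ^ k) by ring]
      set x := a * q ^ k
      have h1x : 0 < 1 - x := by linarith
      have he := Real.add_one_le_exp ((4 / ((k : ℝ) + 1) ^ 2) * (θ ^ 2 / ε ^ 2))
      have hyl : (1 - x) ^ 2 ≤ 1 + (-2 * (-x) * c + (-x) ^ 2) := by
        nlinarith [Real.neg_one_le_cos θ]
      set y := 1 + (-2 * (-x) * c + (-x) ^ 2) with hy
      have hy0 : 0 < y := lt_of_lt_of_le (by positivity) hyl
      calc 1 + (-2 * (-x) * 1 + (-x) ^ 2) ≤ y + x * θ ^ 2 := by rw [hy]; nlinarith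
        _ = y * (x / y * θ ^ 2 + 1) := by field_simp; ring
        _ ≤ y * (x / (1 - x) ^ 2 * θ ^ 2 + 1) := by gcongr
        _ ≤ y * Real.exp ((4 / ((k : ℝ) + 1) ^ 2) * (θ ^ 2 / ε ^ 2)) := by
          gcongr; linarith
noncomputable def Pf (A C θ : ℝ) : ℝ :=
  (2 - 2 * Real.cos (2 * θ)) /
    ((1 - 2 * A * Real.cos θ + A ^ 2) * (1 - 2 * C * Real.cos θ + C ^ 2))

noncomputable def rhof (q A B C D θ : ℝ) : ℝ :=
  (Qf q q (Real.cos (2 * θ)) / Qf q q 1) /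
    ((Qf q (A * q) (Real.cos θ) / Qf q (A * q) 1) * (Qf q B (Real.cos θ) / Qf q B 1) *
      (Qf q (C * q) (Real.cos θ) / Qf q (C * q) 1) * (Qf q D (Real.cos θ) / Qf q D 1))

noncomputable def Kf (q A B C D : ℝ) : ℝ :=
  Qf q q 1 / (Qf q (A * q) 1 * Qf q B 1 * Qf q (C * q) 1 * Qf q D 1)

noncomputable def Gf (q A B C D θ : ℝ) : ℝ :=
  Qf q 1 (Real.cos (2 * θ)) / (Qf q A (Real.cos θ) * Qf q B (Real.cos θ) *
        Qf q C (Real.cos θ) * Qf q D (Real.cos θ))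

lemma G_eq {q : ℝ} (h0 : 0 < q) (h1 : q < 1) {A B C D : ℝ} (hn : Qf q q 1 ≠ 0)
    (hA : Qf q (A * q) 1 ≠ 0) (hB : Qf q B 1 ≠ 0) (hC : Qf q (C * q) 1 ≠ 0) (hD : Qf q D 1 ≠ 0)
    (θ : ℝ) : Gf q A B C D θ = Kf q A B C D * (Pf A C θ * rhof q A B C D θ) := by
  unfold Gf Kf Pf rhof
  rw [Q_peel h0 h1 1, Q_peel h0 h1 A, Q_peel h0 h1 C, one_mul]
  simp only [div_eq_mul_inv, mul_inv, inv_inv]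
  have e1 := mul_inv_cancel₀ hn
  have e2 := mul_inv_cancel₀ hA
  have e3 := mul_inv_cancel₀ hB
  have e4 := mul_inv_cancel₀ hC
  have e5 := mul_inv_cancel₀ hD
  set X := (1 - 2 * 1 * Real.cos (2 * θ) + 1 ^ 2) * Qf q q (Real.cos (2 * θ)) *
    ((1 - 2 * A * Real.cos θ + A ^ 2)⁻¹ * (Qf q (A * q) (Real.cos θ))⁻¹ *
      (Qf q B (Real.cos θ))⁻¹ * ((1 - 2 * C * Real.cos θ + C ^ 2)⁻¹ *
      (Qf q (C * q) (Real.cos θ))⁻¹) * (Qf q D (Real.cos θ))⁻¹) with hX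
  have : ∀ a a' b b' c c' d d' n n' : ℝ, n * n' = 1 → a * a' = 1 → b * b' = 1 → c * c' = 1 →
      d * d' = 1 → X = X * ((n * n') * (a * a') * (b * b') * (c * c') * (d * d')) := by
    intro a a' b b' c c' d d' n n' h1 h2 h3 h4 h5
    rw [h1, h2, h3, h4, h5]; ring
  rw [this _ _ _ _ _ _ _ _ _ _ e1 e2 e3 e4 e5, hX]
  ring

lemma rho_bounds {ε A C b d : ℝ} (hε : 0 < ε) (hA : 0 < A) (hA1 : A ≤ 1) (hC : 0 < C)
    (hC1 : C ≤ 1) (hb : 0 < b) (hb1 : b ≤ Real.exp (-(ε / 2))) (hd : 0 < d)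
    (hd1 : d ≤ Real.exp (-(ε / 2))) (θ : ℝ) :
    Real.exp (-(6 * (Mc * θ ^ 2 / ε ^ 2))) ≤ rhof (Real.exp (-ε)) A (-b) C (-d) θ ∧
    rhof (Real.exp (-ε)) A (-b) C (-d) θ ≤ Real.exp (6 * (Mc * θ ^ 2 / ε ^ 2)) := by
  have hqq : Real.exp (-ε) ≤ Real.exp (-(ε / 2)) := Real.exp_le_exp.2 (by linarith)
  have hq0 := Real.exp_pos (-ε)
  obtain ⟨n0, n1, n2, -⟩ := Q_bounds (θ := 2 * θ) hε hq0 hqq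
  obtain ⟨a0, a1, a2, -⟩ := Q_bounds (θ := θ) (a := A * Real.exp (-ε)) hε (by positivity)
    (le_trans (by nlinarith) hqq)
  obtain ⟨c0, c1, c2, -⟩ := Q_bounds (θ := θ) (a := C * Real.exp (-ε)) hε (by positivity)
    (le_trans (by nlinarith) hqq)
  obtain ⟨-, -, -, b0, b1, b2⟩ := Q_bounds (θ := θ) hε hb hb1
  obtain ⟨-, -, -, d0, d1, d2⟩ := Q_bounds (θ := θ) hε hd hd1
  have e4 : Mc * (2 * θ) ^ 2 / ε ^ 2 = 4 * (Mc * θ ^ 2 / ε ^ 2) := by ring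
  rw [e4] at n2
  have hs0 : 0 ≤ Mc * θ ^ 2 / ε ^ 2 := by have := Mc_nonneg; positivity
  set s := Mc * θ ^ 2 / ε ^ 2
  have hE : 0 < Real.exp s := Real.exp_pos s
  unfold rhof
  rw [← div_le_iff₀' n0] at n2
  rw [← one_le_div n0] at n1
  rw [← div_le_iff₀' a0] at a2
  rw [← one_le_div a0] at a1
  rw [← div_le_iff₀' c0] at c2
  rw [← one_le_div c0] at c1
  rw [← div_le_one b0] at b1
  rw [← div_le_one d0] at d1
  have b3 : Real.exp (-s) ≤ Qf (Real.exp (-ε)) (-b) (Real.cos θ) / Qf (Real.exp (-ε)) (-b) 1 := by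
    rw [le_div_iff₀ b0, Real.exp_neg, inv_mul_le_iff₀ hE]; linarith
  have d3 : Real.exp (-s) ≤ Qf (Real.exp (-ε)) (-d) (Real.cos θ) / Qf (Real.exp (-ε)) (-d) 1 := by
    rw [le_div_iff₀ d0, Real.exp_neg, inv_mul_le_iff₀ hE]; linarith
  generalize Qf (Real.exp (-ε)) (Real.exp (-ε)) (Real.cos (2 * θ)) / _ = n at *
  generalize Qf (Real.exp (-ε)) (A * Real.exp (-ε)) (Real.cos θ) / _ = a at *
  generalize Qf (Real.exp (-ε)) (C * Real.exp (-ε)) (Real.cos θ) / _ = c at *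
  generalize Qf (Real.exp (-ε)) (-b) (Real.cos θ) / _ = B at *
  generalize Qf (Real.exp (-ε)) (-d) (Real.cos θ) / _ = D at *
  have hB0 : 0 < B := lt_of_lt_of_le (Real.exp_pos _) b3
  have hD0 : 0 < D := lt_of_lt_of_le (Real.exp_pos _) d3
  have ha0 : 0 < a := by linarith
  have hc0 : 0 < c := by linarith
  constructor
  · rw [le_div_iff₀ (by positivity)]
    calc Real.exp (-(6 * s)) * (a * B * c * D)
        ≤ Real.exp (-(6 * s)) * (Real.exp s * 1 * Real.exp s * 1) := by gcongr
      _ = Real.exp (-(6 * s) + s + s) := by rw [Real.exp_add, Real.exp_add]; ring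
      _ ≤ 1 := by rw [Real.exp_le_one_iff]; linarith
      _ ≤ n := n1
  · rw [div_le_iff₀ (by positivity)]
    calc n ≤ Real.exp (4 * s) := n2
      _ = Real.exp (6 * s) * (1 * Real.exp (-s) * 1 * Real.exp (-s)) := by
        rw [one_mul, mul_one, ← Real.exp_add, ← Real.exp_add]; congr 1; ring
      _ ≤ _ := by gcongr

lemma P_bounds {A C θ c₁ c₂ : ℝ} (hA : 0 ≤ A) (hC : 0 ≤ C) (hc1 : 0 < c₁) (hc2 : 0 < c₂)
    (h1 : c₁ ≤ 1 - A) (h2 : c₂ ≤ 1 - C) :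
    0 ≤ Pf A C θ ∧ Pf A C θ ≤ 4 * θ ^ 2 / (c₁ ^ 2 * c₂ ^ 2) := by
  have hn0 : 0 ≤ 2 - 2 * Real.cos (2 * θ) := by linarith [Real.cos_le_one (2 * θ)]
  have hn : 2 - 2 * Real.cos (2 * θ) ≤ 4 * θ ^ 2 := by
    linarith [Real.one_sub_sq_div_two_le_cos (x := 2 * θ)]
  have hc := Real.cos_le_one θ
  have hA2 : c₁ ^ 2 ≤ 1 - 2 * A * Real.cos θ + A ^ 2 := by nlinarith
  have hC2 : c₂ ^ 2 ≤ 1 - 2 * C * Real.cos θ + C ^ 2 := by nlinarith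
  have p1 : 0 < c₁ ^ 2 := by positivity
  have p2 : 0 < c₂ ^ 2 := by positivity
  have q1 := p1.trans_le hA2
  have q2 := p2.trans_le hC2
  unfold Pf
  exact ⟨by positivity, by gcongr⟩

/-- asymptotics along `h → 0`, `N h^2 = 1` -/
lemma cos_lim {h : ℕ → ℝ} (hN : ∀ᶠ N : ℕ in atTop, (N : ℝ) * h N ^ 2 = 1)
    (h0 : Tendsto h atTop (𝓝 0)) (y : ℝ) :
    Tendsto (fun N : ℕ => (N : ℝ) * (1 - Real.cos (h N * y))) atTop (𝓝 (y ^ 2 / 2)) := by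
  have h1 : Tendsto (fun N : ℕ => 2 * (y / 2 * Real.sinc (h N * y / 2)) ^ 2) atTop
      (𝓝 (2 * (y / 2 * Real.sinc (0 * y / 2)) ^ 2)) := by
    have := (Real.continuous_sinc.tendsto (0 * y / 2)).comp ((h0.mul_const y).div_const 2)
    exact ((this.const_mul (y / 2)).pow 2).const_mul 2
  have e : 2 * (y / 2 * Real.sinc (0 * y / 2)) ^ 2 = y ^ 2 / 2 := by simp; ring
  rw [e] at h1
  refine h1.congr' ?_
  filter_upwards [hN] with N hN
  have hc : Real.cos (h N * y) = 1 - 2 * Real.sin (h N * y / 2) ^ 2 := by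
    have := Real.cos_sq_add_sin_sq (h N * y / 2)
    have h2 := Real.cos_two_mul (h N * y / 2)
    rw [show 2 * (h N * y / 2) = h N * y by ring] at h2
    rw [h2]; linarith
  have hs : Real.sin (h N * y / 2) = (h N * y / 2) * Real.sinc (h N * y / 2) := by
    by_cases hz : h N * y / 2 = 0
    · rw [hz]; simp
    · rw [Real.sinc_of_ne_zero hz, mul_div_assoc']
      exact (mul_div_cancel_left₀ _ hz).symm
  rw [hc, hs]
  linear_combination (-(y ^ 2 / 2 * Real.sinc (h N * y / 2) ^ 2)) * hN

lemma A_lim {h : ℕ → ℝ} (hpos : ∀ᶠ N : ℕ in atTop, 0 < h N)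
    (hN : ∀ᶠ N : ℕ in atTop, (N : ℝ) * h N ^ 2 = 1)
    (h0 : Tendsto h atTop (𝓝 0)) (a x : ℝ) :
    Tendsto (fun N : ℕ => (N : ℝ) * (1 - 2 * Real.exp (-a * h N) * Real.cos (h N * x)
      + Real.exp (-a * h N) ^ 2)) atTop (𝓝 (x ^ 2 + a ^ 2)) := by
  have hd : HasDerivAt (fun t => Real.exp (-a * t)) (-a) 0 := by
    have := ((hasDerivAt_id (0 : ℝ)).const_mul (-a)).exp
    simpa using this
  have hh : Tendsto h atTop (𝓝[≠] 0) :=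
    tendsto_nhdsWithin_iff.2 ⟨h0, hpos.mono (fun N hN => hN.ne')⟩
  have h1 := (hasDerivAt_iff_tendsto_slope.1 hd).comp hh
  have h2 : Tendsto (fun N => Real.exp (-a * h N)) atTop (𝓝 1) := by
    have := (hd.continuousAt.tendsto).comp h0
    simpa [Function.comp_def] using this
  have h3 := ((h1.pow 2).add ((h2.const_mul 2).mul (cos_lim hN h0 x)))
  have e : (-a) ^ 2 + 2 * 1 * (x ^ 2 / 2) = x ^ 2 + a ^ 2 := by ring
  rw [e] at h3
  refine h3.congr' ?_
  filter_upwards [hpos, hN] with N hp hN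
  simp only [Function.comp, slope_def_field, mul_zero, Real.exp_zero, sub_zero]
  have hi : (N : ℝ) = 1 / h N ^ 2 := by field_simp; linarith
  rw [hi]
  field_simp
  ring
noncomputable def Tf (ψ κ At Ct Bt Dt : ℝ) (N : ℕ) (θ : ℝ) : ℝ :=
  ((N : ℝ) ^ (-(1 / 2 : ℝ))) ^ 2 *
   (Pf (Real.exp (-At * (N : ℝ) ^ (-(1 / 2 : ℝ)))) (Real.exp (-Ct * (N : ℝ) ^ (-(1 / 2 : ℝ)))) θ *
    rhof (Real.exp (-ψ * (N : ℝ) ^ (-κ))) (Real.exp (-At * (N : ℝ) ^ (-(1 / 2 : ℝ))))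
      (-(Real.exp (-ψ * (N : ℝ) ^ (-κ)) * Real.exp (-Bt * (N : ℝ) ^ (-(1 / 2 : ℝ)))))
      (Real.exp (-Ct * (N : ℝ) ^ (-(1 / 2 : ℝ))))
      (-(Real.exp (-ψ * (N : ℝ) ^ (-κ)) * Real.exp (-Dt * (N : ℝ) ^ (-(1 / 2 : ℝ))))) θ)

lemma h_facts {N : ℕ} (hN : 1 ≤ N) : 0 < (N : ℝ) ^ (-(1 / 2 : ℝ)) ∧
    (N : ℝ) * ((N : ℝ) ^ (-(1 / 2 : ℝ))) ^ 2 = 1 ∧ (N : ℝ) ^ (-(1 / 2 : ℝ)) ≤ 1 := by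
  have h1 : (1 : ℝ) ≤ N := by exact_mod_cast hN
  have h0 : (0 : ℝ) < N := by linarith
  refine ⟨Real.rpow_pos_of_pos h0 _, ?_, Real.rpow_le_one_of_one_le_of_nonpos h1 (by norm_num)⟩
  rw [← Real.rpow_natCast, ← Real.rpow_mul h0.le]
  norm_num
  rw [Real.rpow_neg_one]
  exact mul_inv_cancel₀ h0.ne'

lemma h_tendsto : Tendsto (fun N : ℕ => (N : ℝ) ^ (-(1 / 2 : ℝ))) atTop (𝓝 0) :=
  (tendsto_rpow_neg_atTop (by norm_num)).comp tendsto_natCast_atTop_atTop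

lemma he_tendsto {ψ κ : ℝ} (hκ1 : κ < 1 / 2) :
    Tendsto (fun N : ℕ => (N : ℝ) ^ (-(1 / 2 : ℝ)) / (ψ * (N : ℝ) ^ (-κ))) atTop (𝓝 0) := by
  have h1 : Tendsto (fun N : ℕ => (N : ℝ) ^ (-(1 / 2 - κ)) / ψ) atTop (𝓝 (0 / ψ)) :=
    ((tendsto_rpow_neg_atTop (by linarith)).comp tendsto_natCast_atTop_atTop).div_const ψ
  rw [zero_div] at h1
  refine h1.congr' ?_
  filter_upwards [eventually_ge_atTop 1] with N hN
  have h0 : (0 : ℝ) < N := by exact_mod_cast hN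
  rw [show -(1 / 2 - κ) = -(1 / 2 : ℝ) - (-κ) by ring, Real.rpow_sub h0]
  rw [div_div, mul_comm]

lemma exp_le_half {ε h b : ℝ} (h1 : h / ε * (2 * |b|) ≤ 1) (hε : 0 < ε) (hh : 0 < h) :
    Real.exp (-ε) * Real.exp (-b * h) ≤ Real.exp (-(ε / 2)) := by
  rw [← Real.exp_add, Real.exp_le_exp]
  have : h * (2 * |b|) ≤ ε := by
    rw [div_mul_eq_mul_div, div_le_one hε] at h1; exact h1
  nlinarith [neg_abs_le b]

lemma ev_small {ψ κ : ℝ} (hκ1 : κ < 1 / 2) (b : ℝ) : ∀ᶠ N : ℕ in atTop,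
    (N : ℝ) ^ (-(1 / 2 : ℝ)) / (ψ * (N : ℝ) ^ (-κ)) * (2 * |b|) ≤ 1 := by
  have := (he_tendsto (ψ := ψ) hκ1).mul_const (2 * |b|)
  rw [zero_mul] at this
  exact (this.eventually_lt_const one_pos).mono (fun N h => h.le)

lemma rho_ev {ψ κ At Ct Bt Dt : ℝ} (hψ : 0 < ψ) (hκ1 : κ < 1 / 2)
    (hA : 0 < At) (hC : 0 < Ct) : ∀ᶠ N : ℕ in atTop, ∀ θ : ℝ,
    let r := rhof (Real.exp (-ψ * (N : ℝ) ^ (-κ))) (Real.exp (-At * (N : ℝ) ^ (-(1 / 2 : ℝ))))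
      (-(Real.exp (-ψ * (N : ℝ) ^ (-κ)) * Real.exp (-Bt * (N : ℝ) ^ (-(1 / 2 : ℝ)))))
      (Real.exp (-Ct * (N : ℝ) ^ (-(1 / 2 : ℝ))))
      (-(Real.exp (-ψ * (N : ℝ) ^ (-κ)) * Real.exp (-Dt * (N : ℝ) ^ (-(1 / 2 : ℝ))))) θ
    Real.exp (-(6 * (Mc * θ ^ 2 / (ψ * (N : ℝ) ^ (-κ)) ^ 2))) ≤ r ∧
      r ≤ Real.exp (6 * (Mc * θ ^ 2 / (ψ * (N : ℝ) ^ (-κ)) ^ 2)) := by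
  filter_upwards [eventually_ge_atTop 1, ev_small (ψ := ψ) hκ1 Bt, ev_small (ψ := ψ) hκ1 Dt]
    with N hN hb hd θ
  obtain ⟨h0, h1, h2⟩ := h_facts hN
  have hN0 : (0 : ℝ) < N := by exact_mod_cast hN
  have hε : 0 < ψ * (N : ℝ) ^ (-κ) := mul_pos hψ (Real.rpow_pos_of_pos hN0 _)
  rw [show -ψ * (N : ℝ) ^ (-κ) = -(ψ * (N : ℝ) ^ (-κ)) by ring]
  refine rho_bounds hε (Real.exp_pos _) ?_ (Real.exp_pos _) ?_ (by positivity)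
    (exp_le_half hb hε h0) (by positivity) (exp_le_half hd hε h0) θ
  · rw [Real.exp_le_one_iff]; nlinarith
  · rw [Real.exp_le_one_iff]; nlinarith

lemma one_sub_exp_lower {a h : ℝ} (ha : 0 < a) (hh : 0 < h) (h1 : h ≤ 1) :
    a / (1 + a) * h ≤ 1 - Real.exp (-a * h) := by
  have h2 : Real.exp (-a * h) ≤ 1 / (1 + a * h) := by
    rw [neg_mul, Real.exp_neg, ← one_div]
    exact one_div_le_one_div_of_le (by positivity) (by linarith [Real.add_one_le_exp (a * h)])
  have h3 : a / (1 + a) * h ≤ 1 - 1 / (1 + a * h) := by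
    have : 1 - 1 / (1 + a * h) = a * h / (1 + a * h) := by field_simp; ring
    rw [this, div_mul_eq_mul_div]
    gcongr
    nlinarith
  linarith

lemma T_bound {ψ κ At Ct Bt Dt : ℝ} (hψ : 0 < ψ) (hκ1 : κ < 1 / 2)
    (hA : 0 < At) (hC : 0 < Ct) : ∀ᶠ N : ℕ in atTop, ∀ x : ℝ,
    |Tf ψ κ At Ct Bt Dt N ((N : ℝ) ^ (-(1 / 2 : ℝ)) * x)| ≤
      4 / ((At / (1 + At)) ^ 2 * (Ct / (1 + Ct)) ^ 2) * x ^ 2 * Real.exp (x ^ 2 / 40) := by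
  have hs := ((he_tendsto (ψ := ψ) hκ1).pow 2).mul_const (6 * Mc)
  rw [zero_pow two_ne_zero, zero_mul] at hs
  have hs2 := hs.eventually_lt_const (show (0 : ℝ) < 1 / 40 by norm_num)
  filter_upwards [eventually_ge_atTop 1, rho_ev (Bt := Bt) (Dt := Dt) hψ hκ1 hA hC, hs2]
    with N hN hr hs3 x
  obtain ⟨h0, h1, h2⟩ := h_facts hN
  obtain ⟨r1, r2⟩ := hr ((N : ℝ) ^ (-(1 / 2 : ℝ)) * x)
  have hP := P_bounds (A := Real.exp (-At * (N : ℝ) ^ (-(1 / 2 : ℝ))))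
    (C := Real.exp (-Ct * (N : ℝ) ^ (-(1 / 2 : ℝ)))) (θ := (N : ℝ) ^ (-(1 / 2 : ℝ)) * x)
    (Real.exp_pos _).le (Real.exp_pos _).le
    (c₁ := At / (1 + At) * (N : ℝ) ^ (-(1 / 2 : ℝ))) (c₂ := Ct / (1 + Ct) * (N : ℝ) ^ (-(1 / 2 : ℝ)))
    (by positivity) (by positivity) (one_sub_exp_lower hA h0 h2) (one_sub_exp_lower hC h0 h2)
  unfold Tf
  have hr0 := (Real.exp_pos _).trans_le r1
  rw [abs_of_nonneg (mul_nonneg (by positivity) (mul_nonneg hP.1 hr0.le))]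
  have r3 := r2.trans (Real.exp_le_exp.2 (show _ ≤ x ^ 2 / 40 by
    calc 6 * (Mc * ((N : ℝ) ^ (-(1 / 2 : ℝ)) * x) ^ 2 / (ψ * (N : ℝ) ^ (-κ)) ^ 2)
        = ((N : ℝ) ^ (-(1 / 2 : ℝ)) / (ψ * (N : ℝ) ^ (-κ))) ^ 2 * (6 * Mc) * x ^ 2 := by
          rw [div_pow]; ring
      _ ≤ 1 / 40 * x ^ 2 := by gcongr
      _ = x ^ 2 / 40 := by ring))
  set h := (N : ℝ) ^ (-(1 / 2 : ℝ))
  have hp := mul_le_mul hP.2 r3 hr0.le (by positivity)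
  calc _ ≤ h ^ 2 * (4 * (h * x) ^ 2 / ((At / (1 + At) * h) ^ 2 * (Ct / (1 + Ct) * h) ^ 2) *
        Real.exp (x ^ 2 / 40)) := by gcongr
    _ = _ := by field_simp

lemma T_lim {ψ κ At Ct Bt Dt : ℝ} (hψ : 0 < ψ) (hκ1 : κ < 1 / 2)
    (hA : 0 < At) (hC : 0 < Ct) (x : ℝ) :
    Tendsto (fun N : ℕ => Tf ψ κ At Ct Bt Dt N ((N : ℝ) ^ (-(1 / 2 : ℝ)) * x)) atTop
      (𝓝 (4 * x ^ 2 / ((x ^ 2 + At ^ 2) * (x ^ 2 + Ct ^ 2)))) := by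
  have hpos : ∀ᶠ N : ℕ in atTop, 0 < (N : ℝ) ^ (-(1 / 2 : ℝ)) :=
    (eventually_ge_atTop 1).mono (fun N hN => (h_facts hN).1)
  have hN : ∀ᶠ N : ℕ in atTop, (N : ℝ) * ((N : ℝ) ^ (-(1 / 2 : ℝ))) ^ 2 = 1 :=
    (eventually_ge_atTop 1).mono (fun N hN => (h_facts hN).2.1)
  have hs := ((he_tendsto (ψ := ψ) hκ1).pow 2).mul_const (6 * Mc * x ^ 2)
  rw [zero_pow two_ne_zero, zero_mul] at hs
  have hrho : Tendsto (fun N : ℕ => rhof (Real.exp (-ψ * (N : ℝ) ^ (-κ)))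
      (Real.exp (-At * (N : ℝ) ^ (-(1 / 2 : ℝ))))
      (-(Real.exp (-ψ * (N : ℝ) ^ (-κ)) * Real.exp (-Bt * (N : ℝ) ^ (-(1 / 2 : ℝ)))))
      (Real.exp (-Ct * (N : ℝ) ^ (-(1 / 2 : ℝ))))
      (-(Real.exp (-ψ * (N : ℝ) ^ (-κ)) * Real.exp (-Dt * (N : ℝ) ^ (-(1 / 2 : ℝ)))))
      ((N : ℝ) ^ (-(1 / 2 : ℝ)) * x)) atTop (𝓝 1) := by
    have l1 := (Real.continuous_exp.tendsto _).comp hs.neg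
    have l2 := (Real.continuous_exp.tendsto _).comp hs
    rw [neg_zero, Real.exp_zero] at l1
    rw [Real.exp_zero] at l2
    have hev := rho_ev (Bt := Bt) (Dt := Dt) hψ hκ1 hA hC
    refine tendsto_of_tendsto_of_tendsto_of_le_of_le' l1 l2 ?_ ?_
    · filter_upwards [hev] with N hr
      refine le_trans (le_of_eq ?_) (hr _).1
      simp only [Function.comp]
      congr 1; rw [div_pow]; ring
    · filter_upwards [hev] with N hr
      refine le_trans (hr _).2 (le_of_eq ?_)
      simp only [Function.comp]
      congr 1; rw [div_pow]; ring
  have hn := (cos_lim hN h_tendsto (2 * x)).const_mul 2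
  have hd := (A_lim hpos hN h_tendsto At x).mul (A_lim hpos hN h_tendsto Ct x)
  have hne : (x ^ 2 + At ^ 2) * (x ^ 2 + Ct ^ 2) ≠ 0 := by positivity
  have hall := (hn.div hd hne).mul hrho
  rw [show 2 * ((2 * x) ^ 2 / 2) / ((x ^ 2 + At ^ 2) * (x ^ 2 + Ct ^ 2)) * 1 =
    4 * x ^ 2 / ((x ^ 2 + At ^ 2) * (x ^ 2 + Ct ^ 2)) by ring] at hall
  refine hall.congr' ?_
  filter_upwards [hpos, hN] with N hp hN
  unfold Tf Pf
  simp only [Pi.div_apply]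
  refine Eq.trans ?_ (mul_assoc _ _ _)
  congr 1
  rw [show 2 * ((N : ℝ) ^ (-(1 / 2 : ℝ)) * x) = (N : ℝ) ^ (-(1 / 2 : ℝ)) * (2 * x) by ring]
  have hi : (N : ℝ) = 1 / ((N : ℝ) ^ (-(1 / 2 : ℝ))) ^ 2 := by field_simp; linarith
  set h := (N : ℝ) ^ (-(1 / 2 : ℝ))
  generalize Real.cos (h * (2 * x)) = c2
  generalize 1 - 2 * Real.exp (-At * h) * Real.cos (h * x) + Real.exp (-At * h) ^ 2 = a
  generalize 1 - 2 * Real.exp (-Ct * h) * Real.cos (h * x) + Real.exp (-Ct * h) ^ 2 = b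
  have hh : h ≠ 0 := hp.ne'
  rw [hi]
  field_simp
  try ring

lemma T_meas {ψ κ At Ct Bt Dt : ℝ} (hψ : 0 < ψ) {N : ℕ} (hN : 1 ≤ N) :
    Measurable (Tf ψ κ At Ct Bt Dt N) := by
  have hN0 : (0 : ℝ) < N := by exact_mod_cast hN
  have hε : 0 < ψ * (N : ℝ) ^ (-κ) := mul_pos hψ (Real.rpow_pos_of_pos hN0 _)
  have h0 : 0 < Real.exp (-ψ * (N : ℝ) ^ (-κ)) := Real.exp_pos _
  have h1 : Real.exp (-ψ * (N : ℝ) ^ (-κ)) < 1 := by rw [Real.exp_lt_one_iff]; linarith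
  have hc : Measurable Real.cos := Real.measurable_cos
  have hc2 : Measurable (fun θ : ℝ => Real.cos (2 * θ)) := by fun_prop
  have mQ := fun a => (Q_measurable h0 h1 a).comp hc
  have mQ2 := fun a => (Q_measurable h0 h1 a).comp hc2
  simp only [Function.comp_def] at mQ mQ2
  unfold Tf Pf rhof
  refine Measurable.const_mul (Measurable.mul (by fun_prop) ?_) _
  refine ((mQ2 _).div_const _).div ?_
  exact ((((mQ _).div_const _).mul ((mQ _).div_const _)).mul ((mQ _).div_const _)).mul
    ((mQ _).div_const _)

lemma int_bound (K : ℝ) : Integrable (fun x : ℝ =>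
    (1 + x ^ 2) * Real.exp (-(x ^ 2) / 20) * (K * x ^ 2 * Real.exp (x ^ 2 / 40))) := by
  have i2 := integrable_rpow_mul_exp_neg_mul_sq (b := 1 / 40) (by norm_num) (s := 2) (by norm_num)
  have i4 := integrable_rpow_mul_exp_neg_mul_sq (b := 1 / 40) (by norm_num) (s := 4) (by norm_num)
  refine ((i2.const_mul K).add (i4.const_mul K)).congr ?_
  refine Eventually.of_forall (fun x => ?_)
  simp only [Pi.add_apply]
  have e : Real.exp (-(x ^ 2) / 20) * Real.exp (x ^ 2 / 40) = Real.exp (-(1 / 40) * x ^ 2) := by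
    rw [← Real.exp_add]; congr 1; ring
  have e2 : x ^ (2 : ℝ) = x ^ 2 := by exact_mod_cast Real.rpow_natCast x 2
  have e4 : x ^ (4 : ℝ) = x ^ 4 := by exact_mod_cast Real.rpow_natCast x 4
  rw [e2, e4, ← e]
  ring

lemma dct {ψ κ At Ct Bt Dt : ℝ} (hψ : 0 < ψ) (hκ1 : κ < 1 / 2)
    (hA : 0 < At) (hC : 0 < Ct) (w : ℕ → ℝ → ℝ) (W : ℝ → ℝ) (hwm : ∀ N, Measurable (w N))
    (hwb : ∀ᶠ N : ℕ in atTop, ∀ θ : ℝ, |θ| ≤ Real.pi →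
      |w N θ| ≤ (1 + N * θ ^ 2) * Real.exp (-(N * θ ^ 2) / 20))
    (hwl : ∀ x, Tendsto (fun N : ℕ => w N ((N : ℝ) ^ (-(1 / 2 : ℝ)) * x)) atTop (𝓝 (W x))) :
    Tendsto (fun N : ℕ => ∫ x : ℝ, (Set.Ioc (-Real.pi) Real.pi).indicator
      (fun θ => w N θ * Tf ψ κ At Ct Bt Dt N θ) ((N : ℝ) ^ (-(1 / 2 : ℝ)) * x)) atTop
      (𝓝 (∫ x : ℝ, W x * (4 * x ^ 2 / ((x ^ 2 + At ^ 2) * (x ^ 2 + Ct ^ 2))))) := by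
  refine tendsto_integral_filter_of_dominated_convergence _ ?_ ?_
    (int_bound (4 / ((At / (1 + At)) ^ 2 * (Ct / (1 + Ct)) ^ 2))) ?_
  · filter_upwards [eventually_ge_atTop 1] with N hN
    refine Measurable.aestronglyMeasurable ?_
    exact (((hwm N).mul (T_meas hψ hN)).indicator measurableSet_Ioc).comp (measurable_const_mul _)
  · filter_upwards [eventually_ge_atTop 1, hwb,
      T_bound (Bt := Bt) (Dt := Dt) hψ hκ1 hA hC] with N hN hw hT
    refine Eventually.of_forall (fun x => ?_)
    obtain ⟨h0, h1, h2⟩ := h_facts hN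
    by_cases hx : (N : ℝ) ^ (-(1 / 2 : ℝ)) * x ∈ Set.Ioc (-Real.pi) Real.pi
    · rw [Set.indicator_of_mem hx, Real.norm_eq_abs, abs_mul]
      have hw2 := hw _ (abs_le.2 ⟨hx.1.le, hx.2⟩)
      rw [show (N : ℝ) * ((N : ℝ) ^ (-(1 / 2 : ℝ)) * x) ^ 2 = x ^ 2 by
        rw [mul_pow, ← mul_assoc, h1, one_mul]] at hw2
      exact mul_le_mul hw2 (hT x) (abs_nonneg _) (by positivity)
    · rw [Set.indicator_of_notMem hx, norm_zero]
      positivity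
  · refine Eventually.of_forall (fun x => ?_)
    refine ((hwl x).mul (T_lim (Bt := Bt) (Dt := Dt) hψ hκ1 hA hC x)).congr' ?_
    have ht := h_tendsto.mul_const x
    rw [zero_mul] at ht
    have := ht.eventually (Ioo_mem_nhds (neg_lt_zero.2 Real.pi_pos) Real.pi_pos)
    filter_upwards [this] with N hN
    rw [Set.indicator_of_mem (Set.Ioo_subset_Ioc_self hN)]
noncomputable def w0 (N : ℕ) (θ : ℝ) : ℝ := ((1 + Real.cos θ) / 2) ^ N
noncomputable def w1 (N : ℕ) (θ : ℝ) : ℝ :=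
  (N : ℝ) * (((1 + Real.cos θ) / 2) ^ N * (1 / ((1 + Real.cos θ) / 2) - 1))

lemma u_bound {θ : ℝ} (h : |θ| ≤ Real.pi) :
    0 ≤ (1 + Real.cos θ) / 2 ∧ (1 + Real.cos θ) / 2 ≤ Real.exp (-(θ ^ 2) / 10) := by
  refine ⟨by linarith [Real.neg_one_le_cos θ], ?_⟩
  have h1 := Real.cos_le_one_sub_mul_cos_sq h
  have h2 : Real.pi ^ 2 ≤ 10 := by nlinarith [Real.pi_lt_d2, Real.pi_pos]
  have h3 : 1 / 10 * θ ^ 2 ≤ 1 / Real.pi ^ 2 * θ ^ 2 := by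
    gcongr
  have h4 : 2 / Real.pi ^ 2 * θ ^ 2 = 2 * (1 / Real.pi ^ 2 * θ ^ 2) := by ring
  have := Real.add_one_le_exp (-(θ ^ 2) / 10)
  linarith

lemma w0_bound (N : ℕ) {θ : ℝ} (h : |θ| ≤ Real.pi) :
    |w0 N θ| ≤ (1 + N * θ ^ 2) * Real.exp (-(N * θ ^ 2) / 20) := by
  obtain ⟨h0, h1⟩ := u_bound h
  unfold w0
  rw [abs_of_nonneg (pow_nonneg h0 _)]
  have hn : 0 ≤ (N : ℝ) * θ ^ 2 := by positivity
  calc _ ≤ (Real.exp (-(θ ^ 2) / 10)) ^ N := pow_le_pow_left₀ h0 h1 N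
    _ = Real.exp (N * (-(θ ^ 2) / 10)) := by rw [← Real.exp_nat_mul]
    _ ≤ 1 * Real.exp (-(N * θ ^ 2) / 20) := by
      rw [one_mul, Real.exp_le_exp]; linarith
    _ ≤ _ := by gcongr; linarith

lemma w1_bound {N : ℕ} (hN : 2 ≤ N) {θ : ℝ} (h : |θ| ≤ Real.pi) :
    |w1 N θ| ≤ (1 + N * θ ^ 2) * Real.exp (-(N * θ ^ 2) / 20) := by
  obtain ⟨h0, h1⟩ := u_bound h
  have hc : 1 - (1 + Real.cos θ) / 2 ≤ θ ^ 2 / 4 := by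
    linarith [Real.one_sub_sq_div_two_le_cos (x := θ)]
  have hc0 : 0 ≤ 1 - (1 + Real.cos θ) / 2 := by linarith [Real.cos_le_one θ]
  unfold w1
  obtain ⟨m, rfl⟩ : ∃ m, N = m + 1 := ⟨N - 1, by omega⟩
  set u := (1 + Real.cos θ) / 2
  have hm : (1 : ℝ) ≤ m := by
    have : 1 ≤ m := by omega
    exact_mod_cast this
  have e : u ^ (m + 1) * (1 / u - 1) = u ^ m * (1 - u) := by
    by_cases hu : u = 0
    · rw [hu]
      have : m ≠ 0 := by omega
      simp [this]
    · rw [pow_succ, mul_assoc, mul_sub, mul_one_div_cancel hu, mul_one]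
  rw [e, abs_of_nonneg (by positivity)]
  have hn : 0 ≤ θ ^ 2 := by positivity
  have hE : u ^ m ≤ Real.exp (-(((m + 1 : ℕ) : ℝ) * θ ^ 2) / 20) := by
    calc _ ≤ (Real.exp (-(θ ^ 2) / 10)) ^ m := pow_le_pow_left₀ h0 h1 m
      _ = Real.exp (m * (-(θ ^ 2) / 10)) := by rw [← Real.exp_nat_mul]
      _ ≤ _ := by
        rw [Real.exp_le_exp]; push_cast; nlinarith
  calc _ ≤ ((m + 1 : ℕ) : ℝ) * (Real.exp (-(((m + 1 : ℕ) : ℝ) * θ ^ 2) / 20) * (θ ^ 2 / 4)) := by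
        gcongr
    _ = (((m + 1 : ℕ) : ℝ) * θ ^ 2 / 4) * Real.exp (-(((m + 1 : ℕ) : ℝ) * θ ^ 2) / 20) := by ring
    _ ≤ _ := by
      gcongr
      have : 0 ≤ ((m + 1 : ℕ) : ℝ) * θ ^ 2 := by positivity
      linarith

lemma hN_ev : ∀ᶠ N : ℕ in atTop, (N : ℝ) * ((N : ℝ) ^ (-(1 / 2 : ℝ))) ^ 2 = 1 :=
  (eventually_ge_atTop 1).mono (fun N hN => (h_facts hN).2.1)

lemma w0_lim (x : ℝ) : Tendsto (fun N : ℕ => w0 N ((N : ℝ) ^ (-(1 / 2 : ℝ)) * x)) atTop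
    (𝓝 (Real.exp (-x ^ 2 / 4))) := by
  have h1 := (cos_lim hN_ev h_tendsto x).const_mul (-(1 / 2))
  rw [show -(1 / 2) * (x ^ 2 / 2) = -x ^ 2 / 4 by ring] at h1
  have h2 := Real.tendsto_one_add_pow_exp_of_tendsto (t := -x ^ 2 / 4)
    (g := fun N : ℕ => -(1 / 2) * (1 - Real.cos ((N : ℝ) ^ (-(1 / 2 : ℝ)) * x)))
    (h1.congr (fun _ => by ring))
  refine h2.congr (fun N => ?_)
  unfold w0
  congr 1; ring

lemma w1_lim (x : ℝ) : Tendsto (fun N : ℕ => w1 N ((N : ℝ) ^ (-(1 / 2 : ℝ)) * x)) atTop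
    (𝓝 (Real.exp (-x ^ 2 / 4) * (x ^ 2 / 4))) := by
  have h1 := (cos_lim hN_ev h_tendsto x).const_mul (1 / 2)
  have hu : Tendsto (fun N : ℕ => (1 + Real.cos ((N : ℝ) ^ (-(1 / 2 : ℝ)) * x)) / 2) atTop
      (𝓝 1) := by
    have := (((Real.continuous_cos.tendsto _).comp (h_tendsto.mul_const x)).const_add 1).div_const 2
    simpa [Function.comp_def] using this
  have h2 := (w0_lim x).mul (h1.div hu one_ne_zero)
  rw [show 1 / 2 * (x ^ 2 / 2) / 1 = x ^ 2 / 4 by ring] at h2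
  refine h2.congr' ?_
  filter_upwards [hu.eventually_ne one_ne_zero] with N hN
  unfold w0 w1
  simp only [Pi.div_apply]
  have e : 1 / ((1 + Real.cos ((N : ℝ) ^ (-(1 / 2 : ℝ)) * x)) / 2) - 1 =
    (1 / 2 * (1 - Real.cos ((N : ℝ) ^ (-(1 / 2 : ℝ)) * x))) /
      ((1 + Real.cos ((N : ℝ) ^ (-(1 / 2 : ℝ)) * x)) / 2) := by
    rw [eq_div_iff hN, sub_mul, one_div, inv_mul_cancel₀ hN]; ring
  rw [e]; ring

lemma int_eq {ψ κ At Ct Bt Dt : ℝ} {N : ℕ} (hN : 1 ≤ N) (w : ℝ → ℝ)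
    (hw : Function.Periodic w (2 * Real.pi)) (q A B C D : ℝ) (K : ℝ)
    (hG : ∀ θ, Gf q A B C D θ = K * (((N : ℝ) ^ (-(1 / 2 : ℝ)))⁻¹ ^ 2 * Tf ψ κ At Ct Bt Dt N θ)) :
    ∫ θ in (0 : ℝ)..(2 * Real.pi), w θ * Gf q A B C D θ =
      K * ((N : ℝ) ^ (-(1 / 2 : ℝ)))⁻¹ * ∫ x : ℝ, (Set.Ioc (-Real.pi) Real.pi).indicator
      (fun θ => w θ * Tf ψ κ At Ct Bt Dt N θ) ((N : ℝ) ^ (-(1 / 2 : ℝ)) * x) := by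
  obtain ⟨h0, -, -⟩ := h_facts hN
  have hp : Function.Periodic (fun θ => w θ * Gf q A B C D θ) (2 * Real.pi) := by
    intro θ
    simp only [hw θ]
    unfold Gf
    rw [Real.cos_add_two_pi, show 2 * (θ + 2 * Real.pi) = 2 * θ + 2 * Real.pi + 2 * Real.pi by ring,
      Real.cos_add_two_pi, Real.cos_add_two_pi]
  have h1 := hp.intervalIntegral_add_eq 0 (-Real.pi)
  rw [zero_add, show -Real.pi + 2 * Real.pi = Real.pi by ring] at h1
  rw [h1, intervalIntegral.integral_of_le (by linarith [Real.pi_pos]),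
    ← integral_indicator measurableSet_Ioc,
    Measure.integral_comp_mul_left (fun y => (Set.Ioc (-Real.pi) Real.pi).indicator
      (fun θ => w θ * Tf ψ κ At Ct Bt Dt N θ) y), abs_of_pos (inv_pos.2 h0), smul_eq_mul,
    ← mul_assoc, ← integral_const_mul]
  congr 1; ext θ
  by_cases hθ : θ ∈ Set.Ioc (-Real.pi) Real.pi
  · rw [Set.indicator_of_mem hθ, Set.indicator_of_mem hθ, hG]; ring
  · rw [Set.indicator_of_notMem hθ, Set.indicator_of_notMem hθ]; ring

lemma I0_eq {q : ℝ} (h0 : 0 < q) (h1 : q < 1) (A B C D : ℝ) (N : ℕ) :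
    Iint0 q A B C D N = ((1 / (4 * Real.pi) * (4 ^ N *
      ∫ θ in (0 : ℝ)..(2 * Real.pi), w0 N θ * Gf q A B C D θ) : ℝ) : ℂ) := by
  unfold Iint0
  rw [Complex.ofReal_mul]
  congr 1
  rw [← intervalIntegral.integral_const_mul, ← intervalIntegral.integral_ofReal]
  congr 1; ext θ
  rw [gfun_eq h0 h1, ← Gf, ← Complex.ofReal_pow, ← Complex.ofReal_mul]
  congr 1
  unfold w0
  rw [← mul_assoc, ← mul_pow]
  congr 2; ring

lemma I1_eq {q : ℝ} (h0 : 0 < q) (h1 : q < 1) (A B C D : ℝ) (N : ℕ) :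
    (N : ℂ) * Iint1 q A B C D N = ((1 / (4 * Real.pi) * (4 ^ N *
      ∫ θ in (0 : ℝ)..(2 * Real.pi), w1 N θ * Gf q A B C D θ) : ℝ) : ℂ) := by
  unfold Iint1
  rw [mul_left_comm, Complex.ofReal_mul]
  congr 1
  rw [← intervalIntegral.integral_const_mul, ← intervalIntegral.integral_const_mul,
    ← intervalIntegral.integral_ofReal]
  congr 1; ext θ
  rw [gfun_eq h0 h1, ← Gf]
  have e : (4 : ℝ) / (2 + 2 * Real.cos θ) - 1 = 1 / ((1 + Real.cos θ) / 2) - 1 := by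
    rw [one_div_div, show 2 + 2 * Real.cos θ = 2 * (1 + Real.cos θ) by ring, ← div_div]; norm_num
  have e2 : (4 : ℂ) / ((2 + 2 * Real.cos θ : ℝ) : ℂ) - 1 =
      ((1 / ((1 + Real.cos θ) / 2) - 1 : ℝ) : ℂ) := by
    rw [← e]; push_cast; rfl
  rw [e2, ← Complex.ofReal_pow, ← Complex.ofReal_mul, ← Complex.ofReal_mul,
    ← Complex.ofReal_natCast, ← Complex.ofReal_mul]
  congr 1
  unfold w1
  rw [show (2 + 2 * Real.cos θ) ^ N = 4 ^ N * ((1 + Real.cos θ) / 2) ^ N by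
    rw [← mul_pow]; congr 1; ring]
  ring

lemma den_pos {At Ct : ℝ} (hA : 0 < At) (hC : 0 < Ct) :
    0 < ∫ x : ℝ, Real.exp (-x ^ 2 / 4) * x ^ 2 / ((x ^ 2 + At ^ 2) * (x ^ 2 + Ct ^ 2)) := by
  have hint : Integrable (fun x : ℝ => Real.exp (-x ^ 2 / 4) * x ^ 2 /
      ((x ^ 2 + At ^ 2) * (x ^ 2 + Ct ^ 2))) := by
    have i0 := (integrable_exp_neg_mul_sq (b := 1 / 4) (by norm_num)).mul_const (1 / Ct ^ 2)
    refine i0.mono' ?_ (Eventually.of_forall (fun x => ?_))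
    · exact Measurable.aestronglyMeasurable (by fun_prop)
    · rw [Real.norm_eq_abs, abs_of_nonneg (by positivity), mul_div_assoc]
      rw [show -x ^ 2 / 4 = -(1 / 4) * x ^ 2 by ring]
      refine mul_le_mul_of_nonneg_left ?_ (Real.exp_pos _).le
      rw [div_le_div_iff₀ (by positivity) (by positivity)]
      have : 0 ≤ x ^ 2 * x ^ 2 := by positivity
      have : 0 ≤ At ^ 2 * x ^ 2 := by positivity
      have : 0 ≤ At ^ 2 * Ct ^ 2 := by positivity
      nlinarith
  rw [integral_pos_iff_support_of_nonneg (fun x => by positivity) hint]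
  refine lt_of_lt_of_le (b := volume (Set.Ioo (0 : ℝ) 1)) (by simp) (measure_mono ?_)
  intro x hx
  have := hx.1
  rw [Function.mem_support]
  positivity

/-- With `q_N = e^{-ψ N^{-κ}}` (`0 ≤ κ < 1/2`), `A_N = e^{-Ã N^{-1/2}}`, `C_N = e^{-C̃ N^{-1/2}}`,
`B_N = -q_N e^{-B̃ N^{-1/2}}`, `D_N = -q_N e^{-D̃ N^{-1/2}}`, one has
`N · I₁(N)/I₀(N) → F(Ã,C̃)` as `N → ∞`. -/
theorem stmt13 (ψ κ At Ct Bt Dt : ℝ) (hψ : 0 < ψ) (hκ0 : 0 ≤ κ) (hκ1 : κ < 1 / 2)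
    (hA : 0 < At) (hC : 0 < Ct) :
    Filter.Tendsto
      (fun N : ℕ =>
        (N : ℂ) *
          (Iint1 (Real.exp (-ψ * (N : ℝ) ^ (-κ)))
              ((Real.exp (-At * (N : ℝ) ^ (-(1 / 2 : ℝ))) : ℝ) : ℂ)
              ((-(Real.exp (-ψ * (N : ℝ) ^ (-κ)) *
                  Real.exp (-Bt * (N : ℝ) ^ (-(1 / 2 : ℝ)))) : ℝ) : ℂ)
              ((Real.exp (-Ct * (N : ℝ) ^ (-(1 / 2 : ℝ))) : ℝ) : ℂ)
              ((-(Real.exp (-ψ * (N : ℝ) ^ (-κ)) *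
                  Real.exp (-Dt * (N : ℝ) ^ (-(1 / 2 : ℝ)))) : ℝ) : ℂ) N /
            Iint0 (Real.exp (-ψ * (N : ℝ) ^ (-κ)))
              ((Real.exp (-At * (N : ℝ) ^ (-(1 / 2 : ℝ))) : ℝ) : ℂ)
              ((-(Real.exp (-ψ * (N : ℝ) ^ (-κ)) *
                  Real.exp (-Bt * (N : ℝ) ^ (-(1 / 2 : ℝ)))) : ℝ) : ℂ)
              ((Real.exp (-Ct * (N : ℝ) ^ (-(1 / 2 : ℝ))) : ℝ) : ℂ)
              ((-(Real.exp (-ψ * (N : ℝ) ^ (-κ)) *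
                  Real.exp (-Dt * (N : ℝ) ^ (-(1 / 2 : ℝ)))) : ℝ) : ℂ) N))
      Filter.atTop (nhds ((Fint At Ct : ℝ) : ℂ)) := by
  have hD0 := dct (Bt := Bt) (Dt := Dt) hψ hκ1 hA hC w0 _
    (fun N => by unfold w0; fun_prop) (Eventually.of_forall (fun N θ h => w0_bound N h)) w0_lim
  have hD1 := dct (Bt := Bt) (Dt := Dt) hψ hκ1 hA hC w1 _
    (fun N => by unfold w1; fun_prop)
    ((eventually_ge_atTop 2).mono (fun N hN θ h => w1_bound hN h)) w1_lim
  have hpos := den_pos hA hC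
  have e0 : ∫ x : ℝ, Real.exp (-x ^ 2 / 4) * (4 * x ^ 2 / ((x ^ 2 + At ^ 2) * (x ^ 2 + Ct ^ 2))) =
      4 * ∫ x : ℝ, Real.exp (-x ^ 2 / 4) * x ^ 2 / ((x ^ 2 + At ^ 2) * (x ^ 2 + Ct ^ 2)) := by
    rw [← integral_const_mul]; congr 1; ext x; ring
  have e1 : ∫ x : ℝ, Real.exp (-x ^ 2 / 4) * (x ^ 2 / 4) *
      (4 * x ^ 2 / ((x ^ 2 + At ^ 2) * (x ^ 2 + Ct ^ 2))) =
      ∫ x : ℝ, Real.exp (-x ^ 2 / 4) * x ^ 4 / ((x ^ 2 + At ^ 2) * (x ^ 2 + Ct ^ 2)) := by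
    congr 1; ext x; ring
  rw [e0] at hD0
  rw [e1] at hD1
  have hdiv := hD1.div hD0 (by positivity)
  have eF : (∫ x : ℝ, Real.exp (-x ^ 2 / 4) * x ^ 4 / ((x ^ 2 + At ^ 2) * (x ^ 2 + Ct ^ 2))) /
      (4 * ∫ x : ℝ, Real.exp (-x ^ 2 / 4) * x ^ 2 / ((x ^ 2 + At ^ 2) * (x ^ 2 + Ct ^ 2))) =
      Fint At Ct := by
    unfold Fint
    rw [mul_comm (4 : ℝ), ← div_div]; ring
  rw [eF] at hdiv
  refine ((Complex.continuous_ofReal.tendsto _).comp hdiv).congr' ?_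
  filter_upwards [eventually_ge_atTop 1, ev_small (ψ := ψ) hκ1 Bt, ev_small (ψ := ψ) hκ1 Dt]
    with N hN hb hd
  obtain ⟨h0, h1, h2⟩ := h_facts hN
  have hN0 : (0 : ℝ) < N := by exact_mod_cast hN
  have hε : 0 < ψ * (N : ℝ) ^ (-κ) := mul_pos hψ (Real.rpow_pos_of_pos hN0 _)
  have hq0 : 0 < Real.exp (-ψ * (N : ℝ) ^ (-κ)) := Real.exp_pos _
  have hq1 : Real.exp (-ψ * (N : ℝ) ^ (-κ)) < 1 := by rw [Real.exp_lt_one_iff]; linarith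
  have hB' := exp_le_half hb hε h0
  have hD' := exp_le_half hd hε h0
  have hqq : Real.exp (-(ψ * (N : ℝ) ^ (-κ))) ≤ Real.exp (-(ψ * (N : ℝ) ^ (-κ) / 2)) :=
    Real.exp_le_exp.2 (by linarith)
  have hA1 : Real.exp (-At * (N : ℝ) ^ (-(1 / 2 : ℝ))) ≤ 1 := by
    rw [Real.exp_le_one_iff]; nlinarith
  have hC1 : Real.exp (-Ct * (N : ℝ) ^ (-(1 / 2 : ℝ))) ≤ 1 := by
    rw [Real.exp_le_one_iff]; nlinarith
  have n0 := (Q_bounds (θ := 0) hε (Real.exp_pos _) hqq).1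
  have a0 := (Q_bounds (θ := 0) (a := Real.exp (-At * (N : ℝ) ^ (-(1 / 2 : ℝ))) *
    Real.exp (-(ψ * (N : ℝ) ^ (-κ)))) hε (by positivity)
    (le_trans (mul_le_of_le_one_left (Real.exp_pos _).le hA1) hqq)).1
  have c0 := (Q_bounds (θ := 0) (a := Real.exp (-Ct * (N : ℝ) ^ (-(1 / 2 : ℝ))) *
    Real.exp (-(ψ * (N : ℝ) ^ (-κ)))) hε (by positivity)
    (le_trans (mul_le_of_le_one_left (Real.exp_pos _).le hC1) hqq)).1
  have b0 := (Q_bounds (θ := 0) hε (by positivity) hB').2.2.2.1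
  have d0 := (Q_bounds (θ := 0) hε (by positivity) hD').2.2.2.1
  rw [← neg_mul] at n0 a0 c0 b0 d0
  have hG := G_eq hq0 hq1 n0.ne' a0.ne' b0.ne' c0.ne' d0.ne'
  have hK : Kf (Real.exp (-ψ * (N : ℝ) ^ (-κ))) (Real.exp (-At * (N : ℝ) ^ (-(1 / 2 : ℝ))))
      (-(Real.exp (-ψ * (N : ℝ) ^ (-κ)) * Real.exp (-Bt * (N : ℝ) ^ (-(1 / 2 : ℝ)))))
      (Real.exp (-Ct * (N : ℝ) ^ (-(1 / 2 : ℝ))))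
      (-(Real.exp (-ψ * (N : ℝ) ^ (-κ)) * Real.exp (-Dt * (N : ℝ) ^ (-(1 / 2 : ℝ))))) ≠ 0 := by
    unfold Kf; positivity
  have hG2 := fun θ => (hG θ).trans (congrArg (fun t => _ * t) (show _ = 
    ((N : ℝ) ^ (-(1 / 2 : ℝ)))⁻¹ ^ 2 * Tf ψ κ At Ct Bt Dt N θ by
      unfold Tf
      rw [← mul_assoc (_ ^ 2), ← mul_pow, inv_mul_cancel₀ h0.ne', one_pow, one_mul]))
  have per0 : Function.Periodic (w0 N) (2 * Real.pi) := fun θ => by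
    unfold w0; rw [Real.cos_add_two_pi]
  have per1 : Function.Periodic (w1 N) (2 * Real.pi) := fun θ => by
    unfold w1; rw [Real.cos_add_two_pi]
  rw [← mul_div_assoc, I1_eq hq0 hq1, I0_eq hq0 hq1, int_eq hN _ per0 _ _ _ _ _ _ hG2,
    int_eq hN _ per1 _ _ _ _ _ _ hG2, ← Complex.ofReal_div]
  simp only [Function.comp, Pi.div_apply]
  congr 1
  have hc : 1 / (4 * Real.pi) * (4 ^ N * (Kf (Real.exp (-ψ * (N : ℝ) ^ (-κ)))
      (Real.exp (-At * (N : ℝ) ^ (-(1 / 2 : ℝ))))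
      (-(Real.exp (-ψ * (N : ℝ) ^ (-κ)) * Real.exp (-Bt * (N : ℝ) ^ (-(1 / 2 : ℝ)))))
      (Real.exp (-Ct * (N : ℝ) ^ (-(1 / 2 : ℝ))))
      (-(Real.exp (-ψ * (N : ℝ) ^ (-κ)) * Real.exp (-Dt * (N : ℝ) ^ (-(1 / 2 : ℝ))))) *
      ((N : ℝ) ^ (-(1 / 2 : ℝ)))⁻¹)) ≠ 0 := by
    have := Real.pi_pos
    refine mul_ne_zero (by positivity) (mul_ne_zero (by positivity) (mul_ne_zero hK ?_))
    exact inv_ne_zero h0.ne'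
  refine (mul_div_mul_left _ _ hc).symm.trans ?_
  congr 1 <;> ring
end
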